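/- Let n ≥ 2 and let f be a nonconstant continuous function on [0,∞) such that x ↦ f(|x|) is positive definite on ℝ^n (i.e. f ∈ Φ_n). Let X = {x_k}_{k≥1} be a sequence of points of ℝ^n of the form x_k = (0, x_{k2}, …, x_{kn}), and let X_n := {x_{kn}}_{k≥1} be the sequence of n-th coordinates. If d_*(X_n) > 0 and D*(X_n) = 0, then x ↦ f(|x|) is strongly X-positive definite. -/

import Mathlib

open MeasureTheory Filter
open scoped ComplexOrder ENNReal RealInnerProductSpace

noncomputable section

/-- The Hilbert space `ℓ²(ℕ)` of square-summable complex sequences. -/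
abbrev ell2 : Type := lp (fun _ : ℕ => ℂ) 2

/-- The standard basis vector `e k` of `ℓ²(ℕ)`. -/
def stdBasis (k : ℕ) : ell2 := lp.single 2 k (1 : ℂ)

/-- A sequence in a normed space is a *Riesz–Fischer sequence* if there is `c > 0` with
`‖∑_{k<m} ξ_k f_k‖² ≥ c ∑_{k<m} |ξ_k|²` for all `m` and all coefficients `ξ`. -/
def IsRieszFischerSeq {F : Type*} [NormedAddCommGroup F] [NormedSpace ℂ F] (f : ℕ → F) : Prop :=
  ∃ c : ℝ, 0 < c ∧ ∀ (m : ℕ) (ξ : Fin m → ℂ),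
    c * ∑ k, ‖ξ k‖ ^ 2 ≤ ‖∑ k, ξ k • f (k : ℕ)‖ ^ 2

/-- A sequence in a normed space is a *Bessel sequence* if there is `C > 0` with
`‖∑_{k<m} ξ_k f_k‖² ≤ C ∑_{k<m} |ξ_k|²` for all `m` and all coefficients `ξ`. -/
def IsBesselSeq {F : Type*} [NormedAddCommGroup F] [NormedSpace ℂ F] (f : ℕ → F) : Prop :=
  ∃ C : ℝ, 0 < C ∧ ∀ (m : ℕ) (ξ : Fin m → ℂ),
    ‖∑ k, ξ k • f (k : ℕ)‖ ^ 2 ≤ C * ∑ k, ‖ξ k‖ ^ 2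

/-- `g` is *strongly `X`-positive definite*: there is `c > 0` such that for every finite
choice of distinct points from (the range of) `X` and all complex coefficients `ξ`,
`∑_{j,k} ξ_k conj(ξ_j) g(y_k − y_j) ≥ c ∑_k |ξ_k|²` (inequality in the complex order). -/
def IsStronglyPosDef {E : Type*} [NormedAddCommGroup E] (X : ℕ → E) (g : E → ℂ) : Prop :=
  ∃ c : ℝ, 0 < c ∧ ∀ (m : ℕ) (y : Fin m → E),
    (∀ i, y i ∈ Set.range X) → Function.Injective y → ∀ ξ : Fin m → ℂ,
      ((c * ∑ k, ‖ξ k‖ ^ 2 : ℝ) : ℂ) ≤ ∑ j, ∑ k, ξ k * (starRingEnd ℂ) (ξ j) * g (y k - y j)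

/-- `g` is a *positive definite function*: it is continuous at `0` and all quadratic forms
`∑_{j,k} ξ_k conj(ξ_j) g(x_k − x_j)` are nonnegative (in the complex order). -/
def IsPosDefFn {E : Type*} [NormedAddCommGroup E] (g : E → ℂ) : Prop :=
  ContinuousAt g 0 ∧ ∀ (m : ℕ) (x : Fin m → E) (ξ : Fin m → ℂ),
    (0 : ℂ)≤ ∑ j, ∑ k, ξ k * (starRingEnd ℂ) (ξ j) * g (x k - x j)

/-- `d_*(X) > 0`: the points of the sequence `X` are uniformly separated. -/
def SeparatedSeq {E : Type*} [MetricSpace E] (X : ℕ → E) : Prop :=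
  ∃ d : ℝ, 0 < d ∧ ∀ k j, k ≠ j → d ≤ dist (X k) (X j)

/-- The upper density `D*(Λ)` of a real sequence: the (limsup form of the) limit of
`n(r)/r`, where `n(r)` is the largest number of terms of `Λ` lying in an interval
of length `r`. -/
def upperDensity (Λ : ℕ → ℝ) : ℝ≥0∞ :=
  Filter.limsup (fun r : ℝ =>
    (⨆ a : ℝ, ∑' _ : {k : ℕ // Λ k ∈ Set.Icc a (a + r)}, (1 : ℝ≥0∞)) / ENNReal.ofReal r)
    Filter.atTop

lemma sinc_upper (y : ℝ) : min 1 (y ^ 2) / 20 ≤ 1 - Real.sinc y := by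
  by_cases hy : |y| ≤ 2
  · have hpi := Real.pi_gt_three
    have hpi2 := Real.pi_lt_d2
    have h1 : Real.sinc y = Real.sinc (y / 2) * Real.cos (y / 2) := by
      by_cases h0 : y = 0
      · simp [h0]
      · rw [Real.sinc_of_ne_zero h0, Real.sinc_of_ne_zero (by positivity)]
        have : Real.sin y = 2 * Real.sin (y / 2) * Real.cos (y / 2) := by
          rw [← Real.sin_two_mul]; ring_nf
        rw [this]; field_simp
    have hy2 : |y / 2| ≤ 1 := by rw [abs_div, abs_two]; linarith
    have h2 : Real.cos (y / 2) ≤ 1 - 2 / Real.pi ^ 2 * (y / 2) ^ 2 :=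
      Real.cos_le_one_sub_mul_cos_sq (by linarith)
    have h3 : 0 ≤ Real.cos (y / 2) := by
      apply Real.cos_nonneg_of_mem_Icc
      rw [abs_le] at hy2
      constructor <;> linarith
    have h4 : Real.sinc y ≤ Real.cos (y / 2) := by
      rw [h1]
      nlinarith [Real.sinc_le_one (y / 2)]
    have h5 : (1 : ℝ) / 5 ≤ 2 / Real.pi ^ 2 := by
      rw [div_le_div_iff₀ (by norm_num) (by positivity)]
      nlinarith
    have h6 : min 1 (y ^ 2) ≤ y ^ 2 := min_le_right _ _
    nlinarith [sq_nonneg y]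
  · push Not at hy
    have h0 : y ≠ 0 := by rintro rfl; simp at hy; linarith
    have h1 := Real.sinc_le_inv_abs h0
    have h2 : |y|⁻¹ ≤ 1 / 2 := by
      rw [inv_eq_one_div]
      exact one_div_le_one_div_of_le (by norm_num) hy.le
    have h6 : min 1 (y ^ 2) ≤ 1 := min_le_left _ _
    linarith

lemma abs_sinc_le_inv {y : ℝ} (h : y ≠ 0) : |Real.sinc y| ≤ |y|⁻¹ := by
  rw [Real.sinc_of_ne_zero h, abs_div, div_eq_mul_inv]
  have := Real.abs_sin_le_one y
  have h2 : 0 ≤ |y|⁻¹ := by positivity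
  nlinarith

lemma prod_min_nat (S : Finset ℕ) (hS : ∀ i ∈ S, 1 ≤ i) (N : ℕ) (hN : 1 ≤ N) :
    Real.exp (-(N : ℝ)) ≤ ∏ i ∈ S, min 1 ((i : ℝ) / N) := by
  have hN0 : (0 : ℝ) < N := by exact_mod_cast hN
  have h1 : ∏ i ∈ Finset.Icc 1 N, ((i : ℝ) / N) ≤ ∏ i ∈ S, min 1 ((i : ℝ) / N) := by
    have e1 : ∏ i ∈ Finset.Icc 1 N, ((i : ℝ) / N)
        ≤ ∏ i ∈ (Finset.Icc 1 N) ∩ S, ((i : ℝ) / N) := by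
      rw [← Finset.prod_inter_mul_prod_sdiff (Finset.Icc 1 N) S]
      apply mul_le_of_le_one_right
      · exact Finset.prod_nonneg fun i _ => by positivity
      · apply Finset.prod_le_one
        · intro i _; positivity
        · intro i hi
          simp only [Finset.mem_sdiff, Finset.mem_Icc] at hi
          rw [div_le_one hN0]
          exact_mod_cast hi.1.2
    refine e1.trans ?_
    have e2 : ∏ i ∈ S, min 1 ((i : ℝ) / N) = ∏ i ∈ (Finset.Icc 1 N) ∩ S, min 1 ((i : ℝ) / N) := by
      symm
      apply Finset.prod_subset Finset.inter_subset_right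
      intro i hi hi2
      have hn : N < i := by
        by_contra hc
        exact hi2 (Finset.mem_inter.2 ⟨Finset.mem_Icc.2 ⟨hS i hi, by omega⟩, hi⟩)
      apply min_eq_left
      rw [le_div_iff₀ hN0, one_mul]
      exact_mod_cast hn.le
    rw [e2]
    apply Finset.prod_le_prod
    · intro i _; positivity
    · intro i hi
      simp only [Finset.mem_inter, Finset.mem_Icc] at hi
      refine le_min ?_ le_rfl
      rw [div_le_one hN0]
      exact_mod_cast hi.1.2
  refine le_trans ?_ h1
  have h2 : ∏ i ∈ Finset.Icc 1 N, ((i : ℝ) / N) = (N.factorial : ℝ) / N ^ N := by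
    rw [Finset.prod_div_distrib]
    congr 1
    · clear h1 hN hN0
      induction N with
      | zero => simp
      | succ n ih => rw [Finset.prod_Icc_succ_top (by omega), ih, Nat.factorial_succ]; push_cast; ring
    · simp
  rw [h2, Real.exp_neg, inv_eq_one_div, div_le_div_iff₀ (Real.exp_pos _) (by positivity)]
  have := Real.pow_div_factorial_le_exp (N : ℝ) hN0.le N
  rw [div_le_iff₀ (by positivity)] at this
  linarith

lemma prod_min_one_side (J : Finset ℕ) (z : ℕ → ℝ) (d β b : ℝ) (hd : 0 < d) (hb : 0 < b)
    (hb1 : b ≤ 1) (hbd : b ≤ β * d) (h1 : ∀ j ∈ J, d ≤ z j)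
    (h2 : ∀ j ∈ J, ∀ l ∈ J, j ≠ l → d ≤ |z j - z l|) (N : ℕ) (hN : 1 ≤ N) :
    b ^ J.card * Real.exp (-(N : ℝ)) ≤ ∏ j ∈ J, min 1 (β / N * z j) := by
  have hN0 : (0 : ℝ) < N := by exact_mod_cast hN
  have hβ : 0 < β := by
    by_contra h; push Not at h
    nlinarith
  set q : ℕ → ℕ := fun j => ⌊z j / d⌋₊ with hq
  have hinj : Set.InjOn q J := by
    intro j hj l hl hjl
    by_contra hne
    have h := h2 j hj l hl hne
    have a1 := Nat.floor_le (div_nonneg (hd.le.trans (h1 j hj)) hd.le)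
    have a2 := Nat.lt_floor_add_one (z j / d)
    have a3 := Nat.floor_le (div_nonneg (hd.le.trans (h1 l hl)) hd.le)
    have a4 := Nat.lt_floor_add_one (z l / d)
    simp only [hq] at hjl
    rw [hjl] at a1 a2
    have : |z j / d - z l / d| < 1 := by rw [abs_lt]; constructor <;> linarith
    rw [← sub_div, abs_div, abs_of_pos hd, div_lt_one hd] at this
    linarith
  have e1 := prod_min_nat (J.image q) (by
    intro i hi
    obtain ⟨j, hj, rfl⟩ := Finset.mem_image.1 hi
    apply Nat.le_floor
    rw [le_div_iff₀ hd]; simpa using h1 j hj) N hN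
  rw [Finset.prod_image hinj] at e1
  calc b ^ J.card * Real.exp (-(N : ℝ)) ≤ b ^ J.card * ∏ j ∈ J, min 1 ((q j : ℝ) / N) := by gcongr
    _ = ∏ j ∈ J, (b * min 1 ((q j : ℝ) / N)) := by rw [Finset.prod_mul_distrib]; simp
    _ ≤ _ := by
      apply Finset.prod_le_prod
      · intro i _; positivity
      · intro j hj
        have a1 := Nat.floor_le (div_nonneg (hd.le.trans (h1 j hj)) hd.le)
        rw [le_div_iff₀ hd] at a1
        apply le_min
        · have : min 1 ((q j : ℝ) / N) ≤ 1 := min_le_left _ _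
          nlinarith
        · calc b * min 1 ((q j : ℝ) / N) ≤ b * ((q j : ℝ) / N) := by gcongr; exact min_le_right _ _
            _ ≤ (β * d) * ((q j : ℝ) / N) := by gcongr
            _ = β / N * (q j * d) := by ring
            _ ≤ _ := by gcongr

lemma prod_min_two_side (J : Finset ℕ) (y : ℕ → ℝ) (d β b : ℝ) (hd : 0 < d) (hb : 0 < b)
    (hb1 : b ≤ 1) (hbd : b ≤ β * d) (h1 : ∀ j ∈ J, d ≤ |y j|)
    (h2 : ∀ j ∈ J, ∀ l ∈ J, j ≠ l → d ≤ |y j - y l|) (N : ℕ) (hN : 1 ≤ N) (hJ : J.card ≤ N) :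
    (b * Real.exp (-2)) ^ N ≤ ∏ j ∈ J, min 1 (β / N * |y j|) := by
  have p1 := prod_min_one_side (J.filter (fun j => 0 ≤ y j)) (fun j => |y j|) d β b hd hb hb1 hbd
    (fun j hj => h1 j (Finset.mem_filter.1 hj).1)
    (fun j hj l hl hjl => by
      rw [Finset.mem_filter] at hj hl
      have := h2 j hj.1 l hl.1 hjl
      simpa [abs_of_nonneg hj.2, abs_of_nonneg hl.2] using this) N hN
  have p2 := prod_min_one_side (J.filter (fun j => ¬ 0 ≤ y j)) (fun j => |y j|) d β b hd hb hb1 hbd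
    (fun j hj => h1 j (Finset.mem_filter.1 hj).1)
    (fun j hj l hl hjl => by
      rw [Finset.mem_filter] at hj hl
      have := h2 j hj.1 l hl.1 hjl
      have k1 := not_le.1 hj.2
      have k2 := not_le.1 hl.2
      simp only [abs_of_neg k1, abs_of_neg k2]
      rw [abs_sub_comm] at this
      convert this using 2
      ring) N hN
  rw [← Finset.prod_filter_mul_prod_filter_not J (fun j => 0 ≤ y j)]
  refine le_trans ?_ (mul_le_mul p1 p2 (by positivity) (Finset.prod_nonneg fun j _ => ?_))
  · have hc := Finset.card_filter_add_card_filter_not (s := J) (fun j => 0 ≤ y j)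
    calc (b * Real.exp (-2)) ^ N = b ^ N * Real.exp (-(N : ℝ)) * Real.exp (-(N : ℝ)) := by
          rw [mul_pow, ← Real.exp_nat_mul, mul_assoc, ← Real.exp_add]; ring_nf
      _ ≤ b ^ J.card * Real.exp (-(N : ℝ)) * Real.exp (-(N : ℝ)) := by
          gcongr ?_ * _ * _
          exact pow_le_pow_of_le_one hb.le hb1 hJ
      _ = _ := by rw [← hc, pow_add]; ring
  · have hβ : 0 < β := by
      by_contra h; push Not at h
      nlinarith
    positivity

lemma sep_sum (Λ : ℕ → ℝ) (d : ℝ) (hd : 0 < d) (hsep : ∀ k j, k ≠ j → d ≤ |Λ k - Λ j|) :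
    ∃ S : ℝ, 0 < S ∧ ∀ (x : ℝ) (s : Finset ℕ), ∑ k ∈ s, 1 / (1 + (Λ k - x) ^ 2) ≤ S := by
  have hsum : Summable (fun i : ℤ => 1 / (1 + (i : ℝ) ^ 2)) := by
    have h0 : Summable (fun i : ℤ => 1 / ((i : ℝ) ^ 2)) := by
      simpa using Real.summable_one_div_int_pow (p := 2) |>.2 (by norm_num)
    have h3 : Summable (fun i : ℤ => if i = 0 then (1 : ℝ) else 0) :=
      summable_of_ne_finset_zero (s := {0}) (by intro i hi; simp at hi; simp [hi])
    refine Summable.of_nonneg_of_le (fun i => by positivity) (fun i => ?_) (h0.add h3)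
    by_cases hi : i = 0
    · simp [hi]
    · have : (0 : ℝ) < (i : ℝ) ^ 2 := by
        have : (i : ℝ) ≠ 0 := by exact_mod_cast hi
        positivity
      simp only [hi, if_false, add_zero]
      exact one_div_le_one_div_of_le this (by linarith)
  set A : ℝ := 3 + 2 / d ^ 2 with hA
  have hA0 : 0 < A := by positivity
  have key : ∀ y : ℝ, 1 / (1 + y ^ 2) ≤ A * (1 / (1 + (⌊y / d⌋ : ℝ) ^ 2)) := by
    intro y
    have a1 := Int.floor_le (y / d)
    have a2 := Int.lt_floor_add_one (y / d)
    set i : ℝ := (⌊y / d⌋ : ℝ)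
    have hsq : i ^ 2 ≤ 2 * (y / d) ^ 2 + 2 := by
      nlinarith [sq_nonneg (i - 2 * (y / d)), sq_nonneg (y / d - i)]
    rw [mul_one_div, div_le_div_iff₀ (by positivity) (by positivity)]
    have e : (y / d) ^ 2 = y ^ 2 / d ^ 2 := by rw [div_pow]
    have : 1 + i ^ 2 ≤ 3 + 2 * (y ^ 2 / d ^ 2) := by rw [← e]; linarith
    have h2 : A * (1 + y ^ 2) = 3 + 2 * (y ^ 2 / d ^ 2) + 3 * y ^ 2 + 2 / d ^ 2 := by
      rw [hA]; ring
    have h3 : 0 ≤ 2 / d ^ 2 := by positivity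
    nlinarith [sq_nonneg y]
  refine ⟨A * ∑' i : ℤ, 1 / (1 + (i : ℝ) ^ 2), ?_, ?_⟩
  · apply mul_pos hA0
    exact hsum.tsum_pos (fun i => by positivity) 0 (by norm_num)
  · intro x s
    have hinj : Set.InjOn (fun k => ⌊(Λ k - x) / d⌋) s := by
      intro j _ l _ hjl
      by_contra hne
      have h := hsep j l hne
      have hjl' : ⌊(Λ j - x) / d⌋ = ⌊(Λ l - x) / d⌋ := hjl
      have a1 := Int.floor_le ((Λ j - x) / d)
      have a2 := Int.lt_floor_add_one ((Λ j - x) / d)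
      have a3 := Int.floor_le ((Λ l - x) / d)
      have a4 := Int.lt_floor_add_one ((Λ l - x) / d)
      rw [hjl'] at a1 a2
      have : |(Λ j - x) / d - (Λ l - x) / d| < 1 := by rw [abs_lt]; constructor <;> linarith
      rw [← sub_div, abs_div, abs_of_pos hd, div_lt_one hd] at this
      have e : Λ j - x - (Λ l - x) = Λ j - Λ l := by ring
      rw [e] at this
      linarith
    calc ∑ k ∈ s, 1 / (1 + (Λ k - x) ^ 2)
        ≤ ∑ k ∈ s, A * (1 / (1 + (⌊(Λ k - x) / d⌋ : ℝ) ^ 2)) := Finset.sum_le_sum fun k _ => key _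
      _ = A * ∑ i ∈ s.image (fun k => ⌊(Λ k - x) / d⌋), 1 / (1 + (i : ℝ) ^ 2) := by
        rw [Finset.sum_image hinj, Finset.mul_sum]
      _ ≤ _ := by
        gcongr
        exact hsum.sum_le_tsum _ (fun i _ => by positivity)
lemma density_count (Λ : ℕ → ℝ) (h : upperDensity Λ = 0) (B : ℝ) (hB : 0 < B) :
    ∀ᶠ N : ℕ in atTop, ∀ (x : ℝ) (t : Finset ℕ), (∀ k ∈ t, Λ k ∈ Set.Icc x (x + B * N)) →
      t.card ≤ N := by
  have h1 : ∀ᶠ r : ℝ in atTop,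
      (⨆ a : ℝ, ∑' _ : {k : ℕ // Λ k ∈ Set.Icc a (a + r)}, (1 : ℝ≥0∞)) / ENNReal.ofReal r
        < ENNReal.ofReal (1 / B) := by
    refine Filter.eventually_lt_of_limsup_lt (?_ : upperDensity Λ < _) (by isBoundedDefault)
    rw [h]; simpa using hB
  have h2 : Tendsto (fun N : ℕ => B * (N : ℝ)) atTop atTop :=
    tendsto_natCast_atTop_atTop.const_mul_atTop hB
  filter_upwards [h2.eventually h1, eventually_ge_atTop 1] with N hN hN1 x t ht
  have hN0 : (0 : ℝ) < N := by exact_mod_cast hN1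
  have hr : 0 < B * N := by positivity
  rw [ENNReal.div_lt_iff (by simp [hr]) (by simp)] at hN
  rw [← ENNReal.ofReal_mul (by positivity)] at hN
  have e : 1 / B * (B * N) = N := by field_simp
  rw [e, ENNReal.ofReal_natCast] at hN
  have h3 := (le_iSup (fun a : ℝ => ∑' _ : {k : ℕ // Λ k ∈ Set.Icc a (a + B * N)}, (1 : ℝ≥0∞)) x).trans hN.le
  have h4 : (t.card : ℝ≥0∞) ≤ ∑' _ : {k : ℕ // Λ k ∈ Set.Icc x (x + B * N)}, (1 : ℝ≥0∞) := by
    have := ENNReal.sum_le_tsum (f := fun _ : {k : ℕ // Λ k ∈ Set.Icc x (x + B * N)} => (1 : ℝ≥0∞))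
      (t.attach.map ⟨fun k => ⟨k.1, ht k.1 k.2⟩, by
        intro a b hab; exact Subtype.ext (Subtype.mk.inj hab)⟩)
    simpa only [Finset.sum_const, Finset.card_map, Finset.card_attach, nsmul_eq_mul, mul_one] using this
  exact_mod_cast h4.trans h3
open scoped FourierTransform

/-- Continuous integrable functions with Fourier transform supported in `[-a, a]`. -/
def BandLim (a : ℝ) (φ : ℝ → ℂ) : Prop :=
  Continuous φ ∧ Integrable φ ∧ ∀ t, a < |t| → 𝓕 φ t = 0

lemma sinc_integral (τ v : ℝ) (hτ : 0 < τ) :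
    ∫ s in (-τ)..τ, Complex.exp (((2 * Real.pi * v * s : ℝ) : ℂ) * Complex.I)
      = 2 * τ * Real.sinc (2 * Real.pi * τ * v) := by
  by_cases hv : v = 0
  · simp [hv]; ring
  have hc : (2 * Real.pi * v : ℝ) ≠ 0 := by have := Real.pi_pos; positivity
  have h1 := integral_exp_mul_I_eq_sinc (2 * Real.pi * v * τ)
  have h2 := intervalIntegral.integral_comp_mul_left (a := -τ) (b := τ)
    (fun s : ℝ => Complex.exp ((s : ℂ) * Complex.I)) hc
  rw [h2]
  have e : 2 * Real.pi * v * -τ = -(2 * Real.pi * v * τ) := by ring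
  rw [e, h1]
  have e2 : 2 * Real.pi * v * τ = 2 * Real.pi * τ * v := by ring
  rw [e2, Complex.real_smul]
  have hc' : ((2 * Real.pi * v : ℝ) : ℂ) ≠ 0 := by exact_mod_cast hc
  push_cast at hc' ⊢
  field_simp

lemma BandLim.sinc_mul {a τ : ℝ} {φ : ℝ → ℂ} (h : BandLim a φ) (hτ : 0 < τ) :
    BandLim (a + τ) (fun u => (Real.sinc (2 * Real.pi * τ * u) : ℂ) * φ u) := by
  obtain ⟨hc, hi, hv⟩ := h
  have hcs : Continuous (fun u : ℝ => (Real.sinc (2 * Real.pi * τ * u) : ℂ)) :=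
    Complex.continuous_ofReal.comp (Real.continuous_sinc.comp (by fun_prop))
  refine ⟨hcs.mul hc, ?_, ?_⟩
  · refine hi.bdd_mul (c := 1) hcs.aestronglyMeasurable (Eventually.of_forall fun u => ?_)
    simpa using Real.abs_sinc_le_one _
  · intro t ht
    rw [Real.fourier_real_eq_integral_exp_smul]
    have e1 : ∀ v : ℝ, Complex.exp (((-2 * Real.pi * v * t : ℝ) : ℂ) * Complex.I) •
        ((Real.sinc (2 * Real.pi * τ * v) : ℂ) * φ v) =
        (1 / (2 * τ) : ℂ) * ∫ s in Set.Ioc (-τ) τ,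
          Complex.exp (((-2 * Real.pi * v * (t - s) : ℝ) : ℂ) * Complex.I) * φ v := by
      intro v
      have hs := sinc_integral τ v hτ
      have e2 : ∫ s in Set.Ioc (-τ) τ,
          Complex.exp (((-2 * Real.pi * v * (t - s) : ℝ) : ℂ) * Complex.I) * φ v
          = Complex.exp (((-2 * Real.pi * v * t : ℝ) : ℂ) * Complex.I) * φ v *
            ∫ s in (-τ)..τ, Complex.exp (((2 * Real.pi * v * s : ℝ) : ℂ) * Complex.I) := by
        rw [intervalIntegral.integral_of_le (by linarith), ← integral_const_mul]
        congr 1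
        ext s
        rw [mul_right_comm (Complex.exp _) (φ v), ← Complex.exp_add]
        congr 2
        push_cast; ring
      rw [e2, hs, smul_eq_mul]
      have : (τ : ℂ) ≠ 0 := by exact_mod_cast hτ.ne'
      field_simp
    simp_rw [e1]
    rw [integral_const_mul, integral_integral_swap]
    · have : ∀ s ∈ Set.Ioc (-τ) τ,
          ∫ v, Complex.exp (((-2 * Real.pi * v * (t - s) : ℝ) : ℂ) * Complex.I) * φ v = 0 := by
        intro s hs
        have := hv (t - s) (by
          have h1 : |s| ≤ τ := abs_le.2 ⟨hs.1.le, hs.2⟩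
          have h2 := abs_sub_abs_le_abs_sub t s
          linarith)
        rw [Real.fourier_real_eq_integral_exp_smul] at this
        simpa using this
      rw [setIntegral_congr_fun measurableSet_Ioc this]
      simp
    · have hp : Integrable (fun p : ℝ × ℝ => φ p.1 * (1 : ℂ))
          (volume.prod (volume.restrict (Set.Ioc (-τ) τ))) :=
        hi.mul_prod (integrable_const _)
      refine (hp.bdd_mul (c := 1) (f := fun p : ℝ × ℝ => Complex.exp (((-2 * Real.pi * p.1 * (t - p.2) : ℝ) : ℂ) * Complex.I)) ?_ ?_).congr ?_
      · exact Continuous.aestronglyMeasurable (by fun_prop)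
      · exact Eventually.of_forall fun p => by rw [Complex.norm_exp_ofReal_mul_I]
      · exact Eventually.of_forall fun p => by simp [Function.uncurry]

lemma BandLim.mono {a b : ℝ} {φ : ℝ → ℂ} (h : BandLim a φ) (hab : a ≤ b) : BandLim b φ :=
  ⟨h.1, h.2.1, fun t ht => h.2.2 t (hab.trans_lt ht)⟩

lemma BandLim.add {a : ℝ} {φ ψ : ℝ → ℂ} (h : BandLim a φ) (h' : BandLim a ψ) :
    BandLim a (fun u => φ u + ψ u) := by
  refine ⟨h.1.add h'.1, h.2.1.add h'.2.1, fun t ht => ?_⟩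
  have h1 := h.2.2 t ht
  have h2 := h'.2.2 t ht
  rw [Real.fourier_real_eq] at h1 h2 ⊢
  simp_rw [smul_add]
  rw [integral_add, h1, h2, add_zero]
  · have := (Real.fourierIntegral_convergent_iff t).2 h.2.1
    simpa [mul_comm] using this
  · have := (Real.fourierIntegral_convergent_iff t).2 h'.2.1
    simpa [mul_comm] using this

lemma BandLim.const_mul {a : ℝ} {φ : ℝ → ℂ} (h : BandLim a φ) (c : ℂ) :
    BandLim a (fun u => c * φ u) := by
  refine ⟨continuous_const.mul h.1, h.2.1.const_mul c, fun t ht => ?_⟩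
  have h1 := h.2.2 t ht
  rw [Real.fourier_real_eq_integral_exp_smul] at h1 ⊢
  simp_rw [smul_eq_mul] at h1 ⊢
  simp_rw [mul_left_comm _ c]
  rw [integral_const_mul, h1, mul_zero]

lemma BandLim.zero (a : ℝ) : BandLim a (fun _ => 0) :=
  ⟨continuous_const, integrable_zero _ _ _, fun t _ => by
    rw [Real.fourier_real_eq_integral_exp_smul]; simp⟩

lemma BandLim.sum {a : ℝ} (s : Finset ℕ) (φ : ℕ → ℝ → ℂ) (h : ∀ k ∈ s, BandLim a (φ k)) :
    BandLim a (fun u => ∑ k ∈ s, φ k u) := by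
  induction s using Finset.induction_on with
  | empty => simpa using BandLim.zero a
  | insert k s hk ih =>
    simp_rw [Finset.sum_insert hk]
    exact (h k (Finset.mem_insert_self _ _)).add (ih fun j hj => h j (Finset.mem_insert_of_mem hj))

lemma BandLim.translate {a : ℝ} {φ : ℝ → ℂ} (h : BandLim a φ) (x : ℝ) :
    BandLim a (fun u => φ (u - x)) := by
  refine ⟨h.1.comp (by fun_prop), h.2.1.comp_sub_right x, fun t ht => ?_⟩
  have h1 := h.2.2 t ht
  rw [Real.fourier_real_eq_integral_exp_smul] at h1 ⊢
  rw [← integral_add_right_eq_self _ x]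
  have : ∀ v : ℝ, Complex.exp (((-2 * Real.pi * (v + x) * t : ℝ) : ℂ) * Complex.I) • φ (v + x - x)
    = Complex.exp (((-2 * Real.pi * x * t : ℝ) : ℂ) * Complex.I) *
      (Complex.exp (((-2 * Real.pi * v * t : ℝ) : ℂ) * Complex.I) • φ v) := by
    intro v
    rw [smul_eq_mul, smul_eq_mul, ← mul_assoc, ← Complex.exp_add, add_sub_cancel_right]
    congr 2
    push_cast; ring
  simp_rw [this]
  rw [integral_const_mul, h1, mul_zero]

lemma exists_base (a : ℝ) (ha : 0 < a) : ∃ (φ : ℝ → ℂ) (C : ℝ), 0 < C ∧ BandLim a φ ∧ φ 0 = 1 ∧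
    ∀ u, ‖φ u‖ ≤ C * (1 / (1 + u ^ 2)) := by
  let f : ContDiffBump (0 : ℝ) := ⟨a / 2, a, by positivity, by linarith⟩
  let h : ℝ → ℂ := fun x => (f.normed volume x : ℂ)
  have hcs : HasCompactSupport h :=
    f.hasCompactSupport_normed.comp_left (g := fun x : ℝ => (x : ℂ)) (by simp)
  have hsm : ContDiff ℝ (⊤ : ℕ∞) h :=
    Complex.ofRealCLM.contDiff.comp f.contDiff_normed
  let g := hcs.toSchwartzMap hsm
  have hg : ∀ x, g x = h x := fun x => rfl
  let G := 𝓕 g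
  obtain ⟨C0, hC0, h0⟩ := G.decay 0 0
  obtain ⟨C2, hC2, h2⟩ := G.decay 2 0
  refine ⟨G, C0 + C2, by positivity, ⟨G.continuous, G.integrable, ?_⟩, ?_, ?_⟩
  · intro t ht
    have e1 : 𝓕 (G : ℝ → ℂ) t = 𝓕⁻ (G : ℝ → ℂ) (-t) := by
      rw [Real.fourierInv_eq_fourier_neg, neg_neg]
    have e2 : 𝓕⁻ (G : ℝ → ℂ) = g := by
      rw [← SchwartzMap.fourierInv_coe]
      congr 1
      exact FourierTransform.fourierInv_fourier_eq g
    rw [e1, e2, hg]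
    have : f.normed volume (-t) = 0 := by
      have hs := f.support_normed_eq (μ := volume)
      by_contra hne
      have : -t ∈ Function.support (f.normed volume) := hne
      rw [hs] at this
      simp at this
      change |t| < a at this
      linarith
    simp [h, this]
  · change 𝓕 (g : ℝ → ℂ) 0 = 1
    rw [Real.fourier_real_eq_integral_exp_smul]
    simp only [mul_zero, Complex.ofReal_zero, zero_mul, Complex.exp_zero, one_smul, hg, h]
    rw [integral_complex_ofReal, f.integral_normed]; simp
  · intro u
    have k0 := h0 u
    have k2 := h2 u
    simp only [pow_zero, one_mul, norm_iteratedFDeriv_zero, Real.norm_eq_abs, sq_abs] at k0 k2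
    rw [mul_one_div, le_div_iff₀ (by positivity)]
    linarith
lemma BandLim.integrable_fourier {a : ℝ} {φ : ℝ → ℂ} (h : BandLim a φ) : Integrable (𝓕 φ) := by
  have hc : Continuous (𝓕 φ) := VectorFourier.fourierIntegral_continuous Real.continuous_fourierChar
    (by exact continuous_inner) h.2.1
  refine hc.integrable_of_hasCompactSupport ?_
  refine HasCompactSupport.intro (K := Set.Icc (-a) a) isCompact_Icc fun t ht => h.2.2 t ?_
  by_contra hc
  exact ht (abs_le.1 (not_lt.1 hc))

lemma BandLim.plancherel {a : ℝ} {φ : ℝ → ℂ} (h : BandLim a φ) :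
    ∫ t, ‖𝓕 φ t‖ ^ 2 = ∫ x, ‖φ x‖ ^ 2 := by
  have hi := h.integrable_fourier
  have key := VectorFourier.integral_sesq_fourierIntegral_eq_neg_flip (L := innerₗ ℝ)
    (μ := volume) (ν := volume) (innerSL ℂ (E := ℂ))
    Real.continuous_fourierChar continuous_inner h.2.1 hi
  have e2 : ∀ x, VectorFourier.fourierIntegral Real.fourierChar volume (-(innerₗ ℝ).flip) (𝓕 φ) x = φ x := by
    intro x
    have := congrFun (h.1.fourierInv_fourier_eq h.2.1 hi) x
    rw [← this, Real.fourierInv_eq]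
    simp [VectorFourier.fourierIntegral]
  simp_rw [e2] at key
  have e1 : ∀ t, VectorFourier.fourierIntegral Real.fourierChar volume (innerₗ ℝ) φ t = 𝓕 φ t := fun t => rfl
  simp_rw [e1, innerSL_apply_apply, inner_self_eq_norm_sq_to_K] at key
  have k2 : ((∫ t, ‖𝓕 φ t‖ ^ 2 : ℝ) : ℂ) = ((∫ x, ‖φ x‖ ^ 2 : ℝ) : ℂ) := by
    rw [← integral_complex_ofReal, ← integral_complex_ofReal]
    push_cast
    exact key
  exact_mod_cast k2

lemma BandLim.dual {a : ℝ} (ha : 0 < a) {φ : ℝ → ℂ} (h : BandLim a φ) (s : Finset ℕ) (ξ : ℕ → ℂ)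
    (Λ : ℕ → ℝ) (r : ℝ) (hr : 0 < r) :
    ‖∑ j ∈ s, (starRingEnd ℂ) (ξ j) * φ (Λ j)‖ ≤ r * (∫ x, ‖φ x‖ ^ 2) +
      1 / (4 * r) * ∫ t in (-a)..a,
        ‖∑ j ∈ s, ξ j * Complex.exp (((2 * Real.pi * Λ j * t : ℝ) : ℂ) * Complex.I)‖ ^ 2 := by
  have hi := h.integrable_fourier
  have hc : Continuous (𝓕 φ) := VectorFourier.fourierIntegral_continuous Real.continuous_fourierChar
    (by exact continuous_inner) h.2.1
  set F : ℝ → ℂ := fun t => ∑ j ∈ s, ξ j * Complex.exp (((2 * Real.pi * Λ j * t : ℝ) : ℂ) * Complex.I) with hF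
  have hFc : Continuous F := by fun_prop
  have h1 : ∀ x, φ x = ∫ t, Complex.exp (((2 * Real.pi * t * x : ℝ) : ℂ) * Complex.I) * 𝓕 φ t := by
    intro x
    have := congrFun (h.1.fourierInv_fourier_eq h.2.1 hi) x
    rw [← this, Real.fourierInv_eq']
    congr 1 with v
    simp only [smul_eq_mul, Real.inner_apply]
    congr 3
    push_cast; ring
  have hset : ∀ (G : ℝ → ℂ), ∫ t, G t * 𝓕 φ t = ∫ t in (-a)..a, G t * 𝓕 φ t := by
    intro G
    rw [intervalIntegral.integral_of_le (by linarith), ← integral_Icc_eq_integral_Ioc]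
    symm
    apply setIntegral_eq_integral_of_forall_compl_eq_zero
    intro t ht
    rw [h.2.2 t, mul_zero]
    by_contra h2
    exact ht (abs_le.1 (not_lt.1 h2))
  have h2 : ∑ j ∈ s, (starRingEnd ℂ) (ξ j) * φ (Λ j)
      = ∫ t in (-a)..a, (starRingEnd ℂ) (F (-t)) * 𝓕 φ t := by
    rw [← hset]
    have e : ∀ t, (starRingEnd ℂ) (F (-t)) * 𝓕 φ t = ∑ j ∈ s, (starRingEnd ℂ) (ξ j) *
        (Complex.exp (((2 * Real.pi * t * Λ j : ℝ) : ℂ) * Complex.I) * 𝓕 φ t) := by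
      intro t
      simp only [hF, map_sum, map_mul, Finset.sum_mul, ← Complex.exp_conj, Complex.conj_ofReal,
        Complex.conj_I]
      refine Finset.sum_congr rfl fun j _ => ?_
      rw [mul_assoc]
      congr 3
      push_cast; ring
    simp_rw [e]
    rw [integral_finsetSum]
    · refine Finset.sum_congr rfl fun j _ => ?_
      rw [integral_const_mul, ← h1]
    · intro j _
      refine Integrable.const_mul ?_ _
      refine hi.bdd_mul (c := 1) (Continuous.aestronglyMeasurable (by fun_prop)) ?_
      exact Eventually.of_forall fun p => by rw [Complex.norm_exp_ofReal_mul_I]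
  have hsq : Integrable (fun t => ‖𝓕 φ t‖ ^ 2) := by
    refine (hc.norm.pow 2).integrable_of_hasCompactSupport ?_
    refine HasCompactSupport.intro (K := Set.Icc (-a) a) isCompact_Icc fun t ht => ?_
    have h0 : 𝓕 φ t = 0 := by
      refine h.2.2 t ?_
      by_contra hc
      exact ht (abs_le.1 (not_lt.1 hc))
    simp [h0]
  rw [h2]
  calc ‖∫ t in (-a)..a, (starRingEnd ℂ) (F (-t)) * 𝓕 φ t‖
      ≤ ∫ t in (-a)..a, ‖(starRingEnd ℂ) (F (-t)) * 𝓕 φ t‖ :=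
        intervalIntegral.norm_integral_le_integral_norm (by linarith)
    _ ≤ ∫ t in (-a)..a, (r * ‖𝓕 φ t‖ ^ 2 + 1 / (4 * r) * ‖F (-t)‖ ^ 2) := by
        apply intervalIntegral.integral_mono_on (by linarith)
        · exact Continuous.intervalIntegrable (by fun_prop) _ _
        · exact Continuous.intervalIntegrable (by fun_prop) _ _
        · intro t _
          rw [norm_mul, RCLike.norm_conj]
          have : r * ‖𝓕 φ t‖ ^ 2 + 1 / (4 * r) * ‖F (-t)‖ ^ 2 - ‖F (-t)‖ * ‖𝓕 φ t‖
            = 1 / (4 * r) * (2 * r * ‖𝓕 φ t‖ - ‖F (-t)‖) ^ 2 := by field_simp; ring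
          have h3 : 0 ≤ 1 / (4 * r) * (2 * r * ‖𝓕 φ t‖ - ‖F (-t)‖) ^ 2 := by positivity
          linarith
    _ = r * (∫ t in (-a)..a, ‖𝓕 φ t‖ ^ 2) + 1 / (4 * r) * ∫ t in (-a)..a, ‖F (-t)‖ ^ 2 := by
        rw [intervalIntegral.integral_add, intervalIntegral.integral_const_mul,
          intervalIntegral.integral_const_mul]
        · exact Continuous.intervalIntegrable (by fun_prop) _ _
        · exact Continuous.intervalIntegrable (by fun_prop) _ _
    _ ≤ _ := by
        rw [intervalIntegral.integral_comp_neg (fun t => ‖F t‖ ^ 2), neg_neg, ← h.plancherel]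
        gcongr
        rw [intervalIntegral.integral_of_le (by linarith)]
        exact setIntegral_le_integral hsq (Eventually.of_forall fun t => by positivity)
lemma BandLim.sinc_pow {a τ : ℝ} {φ : ℝ → ℂ} (h : BandLim a φ) (hτ : 0 < τ) (m : ℕ) :
    BandLim (a + m * τ) (fun u => (Real.sinc (2 * Real.pi * τ * u) : ℂ) ^ m * φ u) := by
  induction m with
  | zero => simpa using h
  | succ m ih =>
    have := ih.sinc_mul hτ
    convert this using 1
    · push_cast; ring
    · ext u; ring

lemma BandLim.sinc_prod {a τ : ℝ} {φ : ℝ → ℂ} (h : BandLim a φ) (hτ : 0 < τ) (J : Finset ℕ)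
    (p q : ℕ → ℝ) :
    BandLim (a + J.card * τ) (fun u => ((∏ j ∈ J, ((Real.sinc (2 * Real.pi * τ * u) - p j) / q j) : ℝ) : ℂ) * φ u) := by
  induction J using Finset.induction_on with
  | empty => simpa using h
  | insert k J hk ih =>
    have h1 := (ih.sinc_mul hτ).const_mul (1 / q k : ℂ)
    have h2 := (ih.const_mul (- p k / q k : ℂ)).mono (b := a + J.card * τ + τ) (by linarith)
    have := h1.add h2
    convert this using 1
    · rw [Finset.card_insert_of_notMem hk]; push_cast; ring
    · ext u
      rw [Finset.prod_insert hk]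
      push_cast; ring

lemma kernel_exists (a d : ℝ) (ha : 0 < a) (hd : 0 < d) : ∃ C K : ℝ, 0 < C ∧ 0 < K ∧
    ∀ (N m : ℕ), 1 ≤ N → 1 ≤ m → ∀ (J : Finset ℕ) (y : ℕ → ℝ), J.card ≤ N →
      (∀ j ∈ J, d ≤ |y j|) → (∀ j ∈ J, ∀ l ∈ J, j ≠ l → d ≤ |y j - y l|) →
      ∃ Ψ : ℝ → ℂ, BandLim a Ψ ∧ Ψ 0 = 1 ∧ (∀ j ∈ J, Ψ (y j) = 0) ∧
        (∀ u, ‖Ψ u‖ ≤ K ^ N * (C * (1 / (1 + u ^ 2)))) ∧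
        (∀ u, 4 * m / a ≤ |u| → ‖Ψ u‖ ≤ K ^ N * (1 / 4) ^ m * (C * (1 / (1 + u ^ 2)))) := by
  obtain ⟨φ, C, hC, hφ, hφ0, hφC⟩ := exists_base (a / 4) (by positivity)
  set b : ℝ := min 1 (a / 4 * d) with hb
  have hb0 : 0 < b := by positivity
  have hpi := Real.pi_gt_three
  refine ⟨C, 40 / (b * Real.exp (-2)) ^ 2, hC, by positivity, ?_⟩
  intro N m hN hm J y hJ h1 h2
  have hN0 : (0 : ℝ) < N := by exact_mod_cast hN
  have hm0 : (0 : ℝ) < m := by exact_mod_cast hm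
  set τ : ℝ := a / 4 / N with hτ
  set ρ : ℝ := a / 4 / m with hρ
  have hτ0 : 0 < τ := by positivity
  have hρ0 : 0 < ρ := by positivity
  have hden : ∀ j ∈ J, (min 1 (τ * |y j|)) ^ 2 / 20 ≤ 1 - Real.sinc (2 * Real.pi * τ * y j) := by
    intro j hj
    refine le_trans ?_ (sinc_upper _)
    have h0 : 0 ≤ min 1 (τ * |y j|) := by positivity
    gcongr
    apply le_min
    · have : min 1 (τ * |y j|) ≤ 1 := min_le_left _ _
      nlinarith
    · have h5 : min 1 (τ * |y j|) ≤ τ * |y j| := min_le_right _ _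
      have h6 : (2 * Real.pi * τ * y j) ^ 2 = (2 * Real.pi) ^ 2 * (τ * |y j|) ^ 2 := by
        rw [mul_pow τ, sq_abs]; ring
      rw [h6]
      have h7 : (min 1 (τ * |y j|)) ^ 2 ≤ (τ * |y j|) ^ 2 := by gcongr
      have h8 : (1 : ℝ) ≤ (2 * Real.pi) ^ 2 := by nlinarith
      nlinarith [sq_nonneg (τ * |y j|)]
  have hyp : ∀ j ∈ J, 0 < min 1 (τ * |y j|) := by
    intro j hj
    have := hd.trans_le (h1 j hj)
    positivity
  have hden0 : ∀ j ∈ J, 0 < 1 - Real.sinc (2 * Real.pi * τ * y j) := fun j hj =>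
    lt_of_lt_of_le (by have := hyp j hj; positivity) (hden j hj)
  set P : ℝ → ℝ := fun u => ∏ j ∈ J, ((Real.sinc (2 * Real.pi * τ * u) - Real.sinc (2 * Real.pi * τ * y j)) /
    (1 - Real.sinc (2 * Real.pi * τ * y j))) with hP
  have hPb : ∀ u, |P u| ≤ (40 / (b * Real.exp (-2)) ^ 2) ^ N := by
    intro u
    have hprod := prod_min_two_side J y d (a / 4) b hd hb0 (min_le_left _ _) (min_le_right _ _) h1 h2 N hN hJ
    change _ ≤ ∏ j ∈ J, min 1 (τ * |y j|) at hprod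
    rw [hP, Finset.abs_prod]
    calc ∏ j ∈ J, |(Real.sinc (2 * Real.pi * τ * u) - Real.sinc (2 * Real.pi * τ * y j)) /
          (1 - Real.sinc (2 * Real.pi * τ * y j))|
        ≤ ∏ j ∈ J, (40 * (1 / (min 1 (τ * |y j|)) ^ 2)) := by
          apply Finset.prod_le_prod
          · intro j _; positivity
          · intro j hj
            have k0 := hyp j hj
            rw [abs_div, abs_of_pos (hden0 j hj), mul_one_div, div_le_div_iff₀ (hden0 j hj) (by positivity)]
            have k1 : |Real.sinc (2 * Real.pi * τ * u) - Real.sinc (2 * Real.pi * τ * y j)| ≤ 2 := by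
              have := abs_sub (Real.sinc (2 * Real.pi * τ * u)) (Real.sinc (2 * Real.pi * τ * y j))
              have := Real.abs_sinc_le_one (2 * Real.pi * τ * u)
              have := Real.abs_sinc_le_one (2 * Real.pi * τ * y j)
              linarith
            have k2 := hden j hj
            have k3 : 0 ≤ (min 1 (τ * |y j|)) ^ 2 := by positivity
            nlinarith
      _ = 40 ^ J.card * (1 / (∏ j ∈ J, min 1 (τ * |y j|)) ^ 2) := by
          rw [Finset.prod_mul_distrib, Finset.prod_div_distrib, Finset.prod_pow]; simp
      _ ≤ 40 ^ N * (1 / ((b * Real.exp (-2)) ^ N) ^ 2) := by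
          gcongr
          norm_num
      _ = _ := by rw [div_pow, mul_one_div, ← pow_mul, ← pow_mul, mul_comm N 2]
  refine ⟨fun u => (P u : ℂ) * ((Real.sinc (2 * Real.pi * ρ * u) : ℂ) ^ m * φ u), ?_, ?_, ?_, ?_, ?_⟩
  · have := ((hφ.sinc_pow hρ0 m).sinc_prod hτ0 J (fun j => Real.sinc (2 * Real.pi * τ * y j))
      (fun j => 1 - Real.sinc (2 * Real.pi * τ * y j)))
    refine this.mono ?_
    have e1 : (m : ℝ) * ρ = a / 4 := by rw [hρ]; field_simp
    have e2 : (N : ℝ) * τ = a / 4 := by rw [hτ]; field_simp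
    have e3 : (J.card : ℝ) * τ ≤ N * τ := by gcongr
    linarith
  · have : P 0 = 1 := by
      rw [hP]
      apply Finset.prod_eq_one
      intro j hj
      rw [mul_zero, Real.sinc_zero, div_self (hden0 j hj).ne']
    simp [this, hφ0]
  · intro j hj
    have : P (y j) = 0 := by
      rw [hP]
      apply Finset.prod_eq_zero hj
      simp
    simp [this]
  · intro u
    rw [norm_mul, norm_mul, norm_pow, Complex.norm_real, Complex.norm_real, Real.norm_eq_abs, Real.norm_eq_abs]
    have k1 : |Real.sinc (2 * Real.pi * ρ * u)| ^ m ≤ 1 := pow_le_one₀ (abs_nonneg _) (Real.abs_sinc_le_one _)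
    calc _ ≤ (40 / (b * Real.exp (-2)) ^ 2) ^ N * (1 * (C * (1 / (1 + u ^ 2)))) := by
          gcongr
          · exact hPb u
          · exact hφC u
      _ = _ := by ring
  · intro u hu
    rw [norm_mul, norm_mul, norm_pow, Complex.norm_real, Complex.norm_real, Real.norm_eq_abs, Real.norm_eq_abs]
    have hu0 : 0 < |u| := lt_of_lt_of_le (by positivity) hu
    have k0 : 2 * Real.pi * ρ * u ≠ 0 := by
      have := abs_pos.1 hu0
      positivity
    have k1 : |Real.sinc (2 * Real.pi * ρ * u)| ≤ 1 / 4 := by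
      refine (abs_sinc_le_inv k0).trans ?_
      rw [inv_eq_one_div]
      apply one_div_le_one_div_of_le (by norm_num)
      rw [abs_mul, abs_of_pos (by positivity : 0 < 2 * Real.pi * ρ)]
      have k2 : ρ * (4 * m / a) = 1 := by rw [hρ]; field_simp
      have k3 : ρ * (4 * m / a) ≤ ρ * |u| := by gcongr
      nlinarith
    calc _ ≤ (40 / (b * Real.exp (-2)) ^ 2) ^ N * ((1 / 4) ^ m * (C * (1 / (1 + u ^ 2)))) := by
          gcongr
          · exact hPb u
          · exact hφC u
      _ = _ := by ring
lemma exp_lower_bound (Λ : ℕ → ℝ) (d : ℝ) (hd : 0 < d)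
    (hsep : ∀ k j, k ≠ j → d ≤ |Λ k - Λ j|) (hdens : upperDensity Λ = 0) (a : ℝ) (ha : 0 < a) :
    ∃ c : ℝ, 0 < c ∧ ∀ (s : Finset ℕ) (ξ : ℕ → ℂ), c * ∑ k ∈ s, ‖ξ k‖ ^ 2 ≤
      ∫ t in (-a)..a,
        ‖∑ j ∈ s, ξ j * Complex.exp (((2 * Real.pi * Λ j * t : ℝ) : ℂ) * Complex.I)‖ ^ 2 := by
  obtain ⟨C, K, hC, hK, hker⟩ := kernel_exists a d ha hd
  obtain ⟨S, hS, hsum⟩ := sep_sum Λ d hd hsep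
  obtain ⟨q0, hq0⟩ := pow_unbounded_of_one_lt K (one_lt_two : (1 : ℝ) < 2)
  set q := q0 + 1 with hq
  have hKq : K ≤ 2 ^ q := hq0.le.trans (pow_le_pow_right₀ (by norm_num) (by omega))
  have hlim : ∀ᶠ N : ℕ in atTop, C * S * (1 / 2 : ℝ) ^ N ≤ 1 / 2 := by
    have h1 : Tendsto (fun N : ℕ => C * S * (1 / 2 : ℝ) ^ N) atTop (nhds (C * S * 0)) :=
      (tendsto_pow_atTop_nhds_zero_of_lt_one (by norm_num) (by norm_num)).const_mul _
    rw [mul_zero] at h1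
    exact h1.eventually_le_const (by norm_num)
  obtain ⟨N, hNc, hN2, hN1⟩ := ((density_count Λ hdens (8 * q / a) (by positivity)).and
    (hlim.and (eventually_ge_atTop 1))).exists
  have hm1 : 1 ≤ q * N := Nat.mul_pos (by omega) (by omega)
  have hsmall : K ^ N * (1 / 4 : ℝ) ^ (q * N) * C * S ≤ 1 / 2 := by
    have h1 : K ^ N ≤ 2 ^ (q * N) := by rw [pow_mul]; gcongr
    have h2 : (2 : ℝ) ^ (q * N) * (1 / 4 : ℝ) ^ (q * N) = (1 / 2) ^ (q * N) := by
      rw [← mul_pow]; norm_num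
    have h3 : (1 / 2 : ℝ) ^ (q * N) ≤ (1 / 2) ^ N :=
      pow_le_pow_of_le_one (by norm_num) (by norm_num) (Nat.le_mul_of_pos_left _ (by omega))
    calc K ^ N * (1 / 4 : ℝ) ^ (q * N) * C * S ≤ 2 ^ (q * N) * (1 / 4 : ℝ) ^ (q * N) * C * S := by gcongr
      _ = (1 / 2) ^ (q * N) * C * S := by rw [h2]
      _ ≤ (1 / 2) ^ N * C * S := by gcongr
      _ ≤ _ := by linarith
  set m := q * N with hm
  set M : ℝ := K ^ N * C with hM
  have hM0 : 0 < M := by positivity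
  set B : ℝ := M ^ 2 * S * Real.pi with hB
  have hB0 : 0 < B := by positivity
  refine ⟨1 / (4 * B), by positivity, ?_⟩
  intro s ξ
  set X := ∑ k ∈ s, ‖ξ k‖ ^ 2 with hX
  have hX0 : 0 ≤ X := Finset.sum_nonneg fun k _ => by positivity
  have hex : ∀ k : ℕ, ∃ Ψ : ℝ → ℂ, BandLim a Ψ ∧ Ψ 0 = 1 ∧
      (∀ j ∈ s.filter (fun j => j ≠ k ∧ |Λ j - Λ k| < 4 * m / a), Ψ (Λ j - Λ k) = 0) ∧
        (∀ u, ‖Ψ u‖ ≤ K ^ N * (C * (1 / (1 + u ^ 2)))) ∧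
        (∀ u, 4 * m / a ≤ |u| → ‖Ψ u‖ ≤ K ^ N * (1 / 4) ^ m * (C * (1 / (1 + u ^ 2)))) := by
    intro k
    apply hker N m hN1 hm1 (s.filter (fun j => j ≠ k ∧ |Λ j - Λ k| < 4 * m / a)) (fun j => Λ j - Λ k)
    · apply hNc (Λ k - 4 * m / a)
      intro j hj
      rw [Finset.mem_filter] at hj
      have h1 := abs_lt.1 hj.2.2
      have e : 8 * q / a * N = 2 * (4 * m / a) := by rw [hm]; push_cast; ring
      rw [e]
      constructor <;> linarith
    · intro j hj
      rw [Finset.mem_filter] at hj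
      exact hsep j k hj.2.1
    · intro j _ l _ hjl
      simpa using hsep j l hjl
  choose Ψ hΨ1 hΨ2 hΨ3 hΨ4 hΨ5 using hex
  set Φ : ℝ → ℂ := fun x => ∑ k ∈ s, ξ k * Ψ k (x - Λ k) with hΦ
  have hΦB : BandLim a Φ :=
    BandLim.sum s (fun k x => ξ k * Ψ k (x - Λ k)) fun k _ => ((hΨ1 k).translate (Λ k)).const_mul (ξ k)
  -- L2 bound
  have hint : ∀ k, Integrable (fun x : ℝ => ‖ξ k‖ ^ 2 * (1 / (1 + (Λ k - x) ^ 2))) := by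
    intro k
    have := (integrable_inv_one_add_sq.comp_sub_left (Λ k)).const_mul (‖ξ k‖ ^ 2)
    simpa [one_div] using this
  have hL2 : ∫ x, ‖Φ x‖ ^ 2 ≤ B * X := by
    have hpt : ∀ x, ‖Φ x‖ ^ 2 ≤ M ^ 2 * S * ∑ k ∈ s, ‖ξ k‖ ^ 2 * (1 / (1 + (Λ k - x) ^ 2)) := by
      intro x
      have h1 : ‖Φ x‖ ≤ M * ∑ k ∈ s, ‖ξ k‖ * (1 / (1 + (Λ k - x) ^ 2)) := by
        rw [hΦ, Finset.mul_sum]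
        refine (norm_sum_le _ _).trans (Finset.sum_le_sum fun k _ => ?_)
        rw [norm_mul]
        have := hΨ4 k (x - Λ k)
        have e : (x - Λ k) ^ 2 = (Λ k - x) ^ 2 := by ring
        rw [e] at this
        calc ‖ξ k‖ * ‖Ψ k (x - Λ k)‖ ≤ ‖ξ k‖ * (K ^ N * (C * (1 / (1 + (Λ k - x) ^ 2)))) := by gcongr
          _ = _ := by rw [hM]; ring
      have h2 : (∑ k ∈ s, ‖ξ k‖ * (1 / (1 + (Λ k - x) ^ 2))) ^ 2 ≤
          (∑ k ∈ s, 1 / (1 + (Λ k - x) ^ 2)) * ∑ k ∈ s, ‖ξ k‖ ^ 2 * (1 / (1 + (Λ k - x) ^ 2)) := by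
        apply Finset.sum_sq_le_sum_mul_sum_of_sq_eq_mul
        · intro k _; positivity
        · intro k _; positivity
        · intro k _; ring
      calc ‖Φ x‖ ^ 2 ≤ (M * ∑ k ∈ s, ‖ξ k‖ * (1 / (1 + (Λ k - x) ^ 2))) ^ 2 := by gcongr
        _ = M ^ 2 * (∑ k ∈ s, ‖ξ k‖ * (1 / (1 + (Λ k - x) ^ 2))) ^ 2 := by ring
        _ ≤ M ^ 2 * ((∑ k ∈ s, 1 / (1 + (Λ k - x) ^ 2)) * ∑ k ∈ s, ‖ξ k‖ ^ 2 * (1 / (1 + (Λ k - x) ^ 2))) := by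
          gcongr
        _ ≤ M ^ 2 * (S * ∑ k ∈ s, ‖ξ k‖ ^ 2 * (1 / (1 + (Λ k - x) ^ 2))) := by
          gcongr
          · exact hsum x s
        _ = _ := by ring
    have hI : Integrable (fun x => M ^ 2 * S * ∑ k ∈ s, ‖ξ k‖ ^ 2 * (1 / (1 + (Λ k - x) ^ 2))) :=
      (integrable_finset_sum s fun k _ => hint k).const_mul _
    calc ∫ x, ‖Φ x‖ ^ 2 ≤ ∫ x, M ^ 2 * S * ∑ k ∈ s, ‖ξ k‖ ^ 2 * (1 / (1 + (Λ k - x) ^ 2)) :=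
          integral_mono_of_nonneg (Eventually.of_forall fun x => by positivity) hI
            (Eventually.of_forall hpt)
      _ = M ^ 2 * S * ∑ k ∈ s, ‖ξ k‖ ^ 2 * Real.pi := by
          rw [integral_const_mul, integral_finsetSum _ fun k _ => hint k]
          congr 1
          refine Finset.sum_congr rfl fun k _ => ?_
          rw [integral_const_mul]
          congr 1
          have := integral_sub_left_eq_self (fun x : ℝ => (1 + x ^ 2)⁻¹) volume (Λ k)
          simp only [one_div]
          rw [this, integral_univ_inv_one_add_sq]
      _ = _ := by rw [← Finset.sum_mul, hB]; ring
  -- near diagonal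
  have hdiag : ∀ j ∈ s, ∀ k ∈ s, ‖Ψ k (Λ j - Λ k) - (if j = k then 1 else 0)‖ ≤
      K ^ N * (1 / 4) ^ m * C * (1 / (1 + (Λ k - Λ j) ^ 2)) := by
    intro j hj k hk
    by_cases hjk : j = k
    · subst hjk
      simp only [sub_self, hΨ2, if_true, norm_zero]
      positivity
    · simp only [hjk, if_false, sub_zero]
      by_cases hn : |Λ j - Λ k| < 4 * m / a
      · rw [hΨ3 k j (Finset.mem_filter.2 ⟨hj, hjk, hn⟩), norm_zero]
        positivity
      · have := hΨ5 k _ (not_lt.1 hn)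
        have e : (Λ j - Λ k) ^ 2 = (Λ k - Λ j) ^ 2 := by ring
        rw [e] at this
        linarith
  set T : ℂ := ∑ j ∈ s, (starRingEnd ℂ) (ξ j) * Φ (Λ j) with hT
  have hTX : ‖T - (X : ℂ)‖ ≤ 1 / 2 * X := by
    have e : T - (X : ℂ) = ∑ j ∈ s, ∑ k ∈ s, (starRingEnd ℂ) (ξ j) * ξ k *
        (Ψ k (Λ j - Λ k) - (if j = k then 1 else 0)) := by
      simp_rw [mul_sub, Finset.sum_sub_distrib]
      congr 1
      · rw [hT]
        refine Finset.sum_congr rfl fun j _ => ?_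
        rw [hΦ, Finset.mul_sum]
        exact Finset.sum_congr rfl fun k _ => by ring
      · rw [hX]
        push_cast
        refine Finset.sum_congr rfl fun j hj => ?_
        simp only [mul_ite, mul_one, mul_zero, Finset.sum_ite_eq, hj, if_true]
        rw [← Complex.conj_mul']
    rw [e]
    set w : ℕ → ℕ → ℝ := fun j k => K ^ N * (1 / 4) ^ m * C * (1 / (1 + (Λ k - Λ j) ^ 2)) with hw
    have hw0 : ∀ j k, 0 ≤ w j k := fun j k => by positivity
    have hwsymm : ∀ j k, w j k = w k j := fun j k => by
      simp only [hw]
      have e : (Λ k - Λ j) ^ 2 = (Λ j - Λ k) ^ 2 := by ring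
      rw [e]
    have hwsum : ∀ j, ∑ k ∈ s, w j k ≤ 1 / 2 := by
      intro j
      simp only [hw]
      rw [← Finset.mul_sum]
      refine le_trans ?_ hsmall
      gcongr
      exact hsum (Λ j) s
    calc ‖∑ j ∈ s, ∑ k ∈ s, (starRingEnd ℂ) (ξ j) * ξ k * (Ψ k (Λ j - Λ k) - (if j = k then 1 else 0))‖
        ≤ ∑ j ∈ s, ∑ k ∈ s, (1 / 2 * (‖ξ j‖ ^ 2 * w j k) + 1 / 2 * (‖ξ k‖ ^ 2 * w k j)) := by
          refine (norm_sum_le _ _).trans (Finset.sum_le_sum fun j hj => ?_)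
          refine (norm_sum_le _ _).trans (Finset.sum_le_sum fun k hk => ?_)
          rw [norm_mul, norm_mul, RCLike.norm_conj, hwsymm k j]
          have h1 : ‖ξ j‖ * ‖ξ k‖ ≤ 1 / 2 * ‖ξ j‖ ^ 2 + 1 / 2 * ‖ξ k‖ ^ 2 := by
            nlinarith [sq_nonneg (‖ξ j‖ - ‖ξ k‖)]
          calc _ ≤ ‖ξ j‖ * ‖ξ k‖ * w j k := by gcongr; exact hdiag j hj k hk
            _ ≤ (1 / 2 * ‖ξ j‖ ^ 2 + 1 / 2 * ‖ξ k‖ ^ 2) * w j k := by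
              gcongr
            _ = _ := by ring
      _ = ∑ j ∈ s, ∑ k ∈ s, ‖ξ j‖ ^ 2 * w j k := by
          simp_rw [Finset.sum_add_distrib]
          rw [Finset.sum_comm (f := fun j k => 1 / 2 * (‖ξ k‖ ^ 2 * w k j))]
          simp_rw [← Finset.mul_sum]
          ring
      _ ≤ ∑ j ∈ s, ‖ξ j‖ ^ 2 * (1 / 2) := by
          refine Finset.sum_le_sum fun j _ => ?_
          rw [← Finset.mul_sum]
          gcongr
          exact hwsum j
      _ = _ := by rw [← Finset.sum_mul, hX]; ring
  have hdual := hΦB.dual ha s ξ Λ (1 / (4 * B)) (by positivity)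
  have hTl : 1 / 2 * X ≤ ‖T‖ := by
    have h1 := norm_sub_norm_le (X : ℂ) T
    rw [norm_sub_rev] at h1
    rw [Complex.norm_real, Real.norm_eq_abs, abs_of_nonneg hX0] at h1
    linarith
  have h3 : 1 / (4 * B) * (∫ x, ‖Φ x‖ ^ 2) ≤ 1 / 4 * X := by
    calc _ ≤ 1 / (4 * B) * (B * X) := by gcongr
      _ = _ := by field_simp
  have h4 : 1 / (4 * (1 / (4 * B))) = B := by field_simp
  rw [h4] at hdual
  have h5 : 1 / 4 * X ≤ B * ∫ t in (-a)..a,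
        ‖∑ j ∈ s, ξ j * Complex.exp (((2 * Real.pi * Λ j * t : ℝ) : ℂ) * Complex.I)‖ ^ 2 := by
    linarith
  rw [one_div, mul_comm, ← div_eq_mul_inv, div_le_iff₀ (by positivity)]
  linarith

lemma long_interval (s : Finset ℕ) (Λ : ℕ → ℝ) (a c : ℝ) (ha : 0 < a)
    (H : ∀ (ξ : ℕ → ℂ), c * ∑ k ∈ s, ‖ξ k‖ ^ 2 ≤ ∫ t in (-a)..a, ‖∑ j ∈ s, ξ j * Complex.exp (((2 * Real.pi * Λ j * t : ℝ) : ℂ) * Complex.I)‖ ^ 2)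
    (ξ : ℕ → ℂ) (N : ℕ) (T : ℝ) :
    N * (c * ∑ k ∈ s, ‖ξ k‖ ^ 2) ≤ ∫ t in T..(T + 2 * a * N), ‖∑ j ∈ s, ξ j * Complex.exp (((2 * Real.pi * Λ j * t : ℝ) : ℂ) * Complex.I)‖ ^ 2 := by
  have hcont : Continuous (fun t : ℝ => ‖∑ j ∈ s, ξ j * Complex.exp (((2 * Real.pi * Λ j * t : ℝ) : ℂ) * Complex.I)‖ ^ 2) := by
    fun_prop
  induction N with
  | zero => simp
  | succ N ih =>
    have h1 := intervalIntegral.integral_add_adjacent_intervals (μ := volume) (hcont.intervalIntegrable T (T + 2 * a * N))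
      (hcont.intervalIntegrable (T + 2 * a * N) (T + 2 * a * (N + 1 : ℕ)))
    rw [← h1]
    set S := T + 2 * a * N + a with hS
    have h2 := H (fun j => ξ j * Complex.exp (((2 * Real.pi * Λ j * S : ℝ) : ℂ) * Complex.I))
    have h3 : ∀ j, ‖ξ j * Complex.exp (((2 * Real.pi * Λ j * S : ℝ) : ℂ) * Complex.I)‖ = ‖ξ j‖ := by
      intro j
      rw [norm_mul, Complex.norm_exp_ofReal_mul_I, mul_one]
    simp only [h3] at h2
    have h4 : (∫ t in (T + 2 * a * N)..(T + 2 * a * (N + 1 : ℕ)), ‖∑ j ∈ s, ξ j * Complex.exp (((2 * Real.pi * Λ j * t : ℝ) : ℂ) * Complex.I)‖ ^ 2)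
        = ∫ t in (-a)..a, ‖∑ j ∈ s, ξ j * Complex.exp (((2 * Real.pi * Λ j * S : ℝ) : ℂ) * Complex.I) * Complex.exp (((2 * Real.pi * Λ j * t : ℝ) : ℂ) * Complex.I)‖ ^ 2 := by
      have h5 := intervalIntegral.integral_comp_add_right (a := -a) (b := a) (fun t : ℝ => ‖∑ j ∈ s, ξ j * Complex.exp (((2 * Real.pi * Λ j * t : ℝ) : ℂ) * Complex.I)‖ ^ 2) S
      have e1 : -a + S = T + 2 * a * N := by rw [hS]; ring
      have e2 : a + S = T + 2 * a * (N + 1 : ℕ) := by rw [hS]; push_cast; ring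
      rw [e1, e2] at h5
      rw [← h5]
      congr 1
      ext t
      congr 3
      ext j
      rw [mul_assoc (ξ j), ← Complex.exp_add]
      congr 2
      push_cast; ring
    rw [h4, Nat.cast_succ, add_mul, one_mul]
    exact add_le_add ih h2

lemma long_interval' (s : Finset ℕ) (Λ : ℕ → ℝ) (a c : ℝ) (ha : 0 < a) (hc : 0 < c)
    (H : ∀ (ξ : ℕ → ℂ), c * ∑ k ∈ s, ‖ξ k‖ ^ 2 ≤ ∫ t in (-a)..a, ‖∑ j ∈ s, ξ j * Complex.exp (((2 * Real.pi * Λ j * t : ℝ) : ℂ) * Complex.I)‖ ^ 2)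
    (ξ : ℕ → ℂ) (ρ : ℝ) (hρ : a ≤ ρ) :
    c / (2 * a) * ∑ k ∈ s, ‖ξ k‖ ^ 2 ≤ (1 / ρ) * ∫ t in (-ρ)..ρ, ‖∑ j ∈ s, ξ j * Complex.exp (((2 * Real.pi * Λ j * t : ℝ) : ℂ) * Complex.I)‖ ^ 2 := by
  have hcont : Continuous (fun t : ℝ => ‖∑ j ∈ s, ξ j * Complex.exp (((2 * Real.pi * Λ j * t : ℝ) : ℂ) * Complex.I)‖ ^ 2) := by
    fun_prop
  have hρ0 : 0 < ρ := ha.trans_le hρ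
  set N := ⌊ρ / a⌋₊ with hN
  have h1 : (N : ℝ) ≤ ρ / a := Nat.floor_le (by positivity)
  have h2 : ρ / a < N + 1 := Nat.lt_floor_add_one _
  have h3 : (1 : ℝ) ≤ N := by
    have : 1 ≤ N := Nat.le_floor (by rw [Nat.cast_one, le_div_iff₀ ha]; linarith)
    exact_mod_cast this
  have h4 : ρ / (2 * a) ≤ N := by
    have : ρ / (2 * a) = (ρ / a) / 2 := by field_simp
    rw [this]; linarith
  have h5 := long_interval s Λ a c ha H ξ N (-ρ)
  have h6 : (N : ℝ) * a ≤ ρ := by rwa [le_div_iff₀ ha] at h1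
  have h7 : (∫ t in (-ρ)..(-ρ + 2 * a * N), ‖∑ j ∈ s, ξ j * Complex.exp (((2 * Real.pi * Λ j * t : ℝ) : ℂ) * Complex.I)‖ ^ 2) ≤
     ∫ t in (-ρ)..ρ, ‖∑ j ∈ s, ξ j * Complex.exp (((2 * Real.pi * Λ j * t : ℝ) : ℂ) * Complex.I)‖ ^ 2 := by
    apply intervalIntegral.integral_mono_interval le_rfl
    · have : 0 ≤ 2 * a * N := by positivity
      linarith
    · nlinarith
    · exact Eventually.of_forall (fun t => by positivity)
    · exact hcont.intervalIntegrable _ _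
  have hS : 0 ≤ c * ∑ k ∈ s, ‖ξ k‖ ^ 2 := by positivity
  have h8 : ρ / (2 * a) * (c * ∑ k ∈ s, ‖ξ k‖ ^ 2) ≤ N * (c * ∑ k ∈ s, ‖ξ k‖ ^ 2) := by gcongr
  rw [one_div, ← div_eq_inv_mul, le_div_iff₀ hρ0]
  calc _ = ρ / (2 * a) * (c * ∑ k ∈ s, ‖ξ k‖ ^ 2) := by field_simp
    _ ≤ _ := by linarith

lemma circle_avg (G : ℝ → ℝ) (hG : Continuous G) (hG0 : ∀ t, 0 ≤ G t) (p q : ℝ) (ρ : ℝ)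
    (hρ : 0 < ρ) (hpq : p ^ 2 + q ^ 2 = ρ ^ 2) :
    (1 / ρ) * (∫ t in (-ρ)..ρ, G t) ≤ ∫ θ in (0 : ℝ)..(2 * Real.pi), G (Real.cos θ * p + Real.sin θ * q) := by
  set z : ℂ := ⟨q, p⟩
  have hz : ‖z‖ = ρ := by
    rw [Complex.norm_def, Complex.normSq_mk, ← Real.sqrt_sq hρ.le, ← hpq]; congr 1; ring
  have hq : q = ρ * Real.cos z.arg := by rw [← hz, Complex.norm_mul_cos_arg]
  have hp : p = ρ * Real.sin z.arg := by rw [← hz, Complex.norm_mul_sin_arg]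
  have h1 : ∀ θ, G (Real.cos θ * p + Real.sin θ * q) = G (ρ * Real.sin (θ + z.arg)) := by
    intro θ; congr 1; rw [Real.sin_add]
    conv_lhs => rw [hp, hq]
    ring
  simp only [h1]
  rw [intervalIntegral.integral_comp_add_right (fun θ => G (ρ * Real.sin θ))]
  have hper : Function.Periodic (fun θ => G (ρ * Real.sin θ)) (2 * Real.pi) := by
    intro θ; simp
  have h2 := hper.intervalIntegral_add_eq (0 + z.arg) (-(Real.pi / 2))
  rw [show 2 * Real.pi + z.arg = 0 + z.arg + 2 * Real.pi by ring, h2]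
  have hc : Continuous (fun θ => G (ρ * Real.sin θ)) := by fun_prop
  have h3 : (∫ θ in (-(Real.pi/2))..(Real.pi/2), G (ρ * Real.sin θ) * (ρ * Real.cos θ)) = ∫ t in (-ρ)..ρ, G t := by
    have := intervalIntegral.integral_comp_mul_deriv (a := -(Real.pi/2)) (b := Real.pi/2) (f := fun θ => ρ * Real.sin θ) (f' := fun θ => ρ * Real.cos θ) (g := G)
      (fun x _ => (Real.hasDerivAt_sin x).const_mul ρ) (by fun_prop) hG
    simpa using this
  rw [← h3, ← intervalIntegral.integral_const_mul]
  calc _ ≤ ∫ θ in (-(Real.pi/2))..(Real.pi/2), G (ρ * Real.sin θ) := by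
        apply intervalIntegral.integral_mono_on (by linarith [Real.pi_pos])
        · exact Continuous.intervalIntegrable (by fun_prop) _ _
        · exact hc.intervalIntegrable _ _
        · intro θ _
          rw [show 1 / ρ * (G (ρ * Real.sin θ) * (ρ * Real.cos θ)) = G (ρ * Real.sin θ) * Real.cos θ by field_simp]
          exact mul_le_of_le_one_right (hG0 _) (Real.cos_le_one _)
    _ ≤ _ := by
        apply intervalIntegral.integral_mono_interval le_rfl (by linarith [Real.pi_pos]) (by linarith [Real.pi_pos])
        · exact Eventually.of_forall (fun t => hG0 _)
        · exact hc.intervalIntegrable _ _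

lemma pd_kernel_integral {V : Type*} [MeasurableSpace V] (ν : Measure V) [IsProbabilityMeasure ν]
    (K : V → V → ℝ) (hK : Measurable (fun p : V × V => K p.1 p.2)) (B : ℝ) (hB : ∀ x y, |K x y| ≤ B)
    (hpos : ∀ (m : ℕ) (x : Fin m → V), 0 ≤ ∑ j, ∑ k, K (x k) (x j)) :
    0 ≤ ∫ p, K p.1 p.2 ∂(ν.prod ν) := by
  set I := ∫ p, K p.1 p.2 ∂(ν.prod ν) with hI
  have key : ∀ M : ℕ, 1 ≤ M → 0 ≤ (M : ℝ) * I + (B - I) := by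
    intro M hM
    set P := Measure.pi (fun _ : Fin M => ν) with hP
    have hmeas : ∀ j k : Fin M, Measurable (fun x : Fin M → V => K (x k) (x j)) := fun j k =>
      hK.comp (f := fun x : Fin M → V => (x k, x j)) ((measurable_pi_apply k).prodMk (measurable_pi_apply j))
    have hint : ∀ j k : Fin M, Integrable (fun x : Fin M → V => K (x k) (x j)) P := fun j k =>
      Integrable.of_bound (hmeas j k).aestronglyMeasurable B (Eventually.of_forall fun x => hB _ _)
    have h0 : 0 ≤ ∫ x, ∑ j, ∑ k, K (x k) (x j) ∂P := integral_nonneg fun x => hpos M x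
    rw [integral_finsetSum _ (fun j _ => integrable_finsetSum _ (fun k _ => hint j k))] at h0
    have h1 : ∀ j k : Fin M, (∫ x, K (x k) (x j) ∂P) ≤ I + if j = k then B - I else 0 := by
      intro j k
      split_ifs with hjk
      · have : (∫ x, K (x k) (x j) ∂P) ≤ ∫ x : Fin M → V, B ∂P :=
          integral_mono (hint j k) (integrable_const _) (fun x => (le_abs_self _).trans (hB _ _))
        simp at this
        linarith
      · have hind : ProbabilityTheory.IndepFun (fun x : Fin M → V => x k) (fun x => x j) P :=
          (ProbabilityTheory.iIndepFun_pi (X := fun _ : Fin M => (id : V → V)) (μ := fun _ => ν)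
            (fun i => aemeasurable_id)).indepFun (Ne.symm hjk)
        rw [ProbabilityTheory.indepFun_iff_map_prod_eq_prod_map_map (measurable_pi_apply k).aemeasurable
          (measurable_pi_apply j).aemeasurable] at hind
        have e : ∀ i : Fin M, P.map (fun x : Fin M → V => x i) = ν := fun i =>
          (measurePreserving_eval (fun _ : Fin M => ν) i).map_eq
        rw [e, e] at hind
        have : I = ∫ x, K (x k) (x j) ∂P := by
          rw [hI, ← hind, integral_map ((measurable_pi_apply k).prodMk (measurable_pi_apply j)).aemeasurable
            hK.aestronglyMeasurable]
        rw [this]; simp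
    have h2 : (∑ j, ∫ x, ∑ k, K (x k) (x j) ∂P) ≤ ∑ j : Fin M, ∑ k : Fin M, (I + if j = k then B - I else 0) := by
      apply Finset.sum_le_sum
      intro j _
      rw [integral_finsetSum _ (fun k _ => hint j k)]
      exact Finset.sum_le_sum fun k _ => h1 j k
    have h3 : (∑ j : Fin M, ∑ k : Fin M, (I + if j = k then B - I else 0)) = M * (M * I + (B - I)) := by
      simp [Finset.sum_add_distrib]; ring
    rw [h3] at h2
    have h4 : 0 ≤ (M : ℝ) * (M * I + (B - I)) := h0.trans h2
    have : (0 : ℝ) < M := by exact_mod_cast hM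
    exact nonneg_of_mul_nonneg_right h4 this
  by_contra hneg
  push Not at hneg
  obtain ⟨M, hM⟩ := exists_nat_gt (max 1 ((B - I) / (-I)))
  have h1 : (1 : ℝ) < M := (le_max_left _ _).trans_lt hM
  have h2 : (B - I) / (-I) < M := (le_max_right _ _).trans_lt hM
  rw [div_lt_iff₀ (by linarith)] at h2
  have := key M (by exact_mod_cast h1.le)
  linarith

section gauss
variable {V : Type*} [NormedAddCommGroup V] [InnerProductSpace ℝ V] [FiniteDimensional ℝ V]
  [MeasurableSpace V] [BorelSpace V]

lemma integrable_gauss (b : ℝ) (hb : 0 < b) : Integrable (fun v : V => Real.exp (-b * ‖v‖ ^ 2)) := by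
  have := (GaussianFourier.integrable_cexp_neg_mul_sq_norm_add (V := V) (b := (b : ℂ)) (by simpa) 0 0).re
  convert this using 2 with v
  simp only [zero_mul, add_zero]
  norm_cast

lemma gauss_pos (b : ℝ) (hb : 0 < b) : 0 < ∫ v : V, Real.exp (-b * ‖v‖ ^ 2) := by
  rw [GaussianFourier.integral_rexp_neg_mul_sq_norm hb]
  have := Real.pi_pos
  positivity

lemma pd_gauss (h : V → ℝ) (hc : Continuous h) (B : ℝ) (hB : ∀ x, |h x| ≤ B)
    (hpos : ∀ (m : ℕ) (x : Fin m → V), 0 ≤ ∑ j, ∑ k, h (x k - x j)) (ε : ℝ) (hε : 0 < ε) :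
    0 ≤ ∫ u, h u * Real.exp (-ε * ‖u‖ ^ 2) := by
  set w : V → ℝ := fun v => Real.exp (-(2 * ε) * ‖v‖ ^ 2) with hw
  have hwc : Continuous w := by fun_prop
  have hwi : Integrable w := integrable_gauss (2 * ε) (by positivity)
  have hw0 : ∀ v, 0 ≤ w v := fun v => (Real.exp_pos _).le
  set C := ∫ v, w v with hC
  have hC0 : 0 < C := gauss_pos (2 * ε) (by positivity)
  set ν : Measure V := volume.withDensity (fun v => ENNReal.ofReal (C⁻¹ * w v)) with hν
  have hνp : IsProbabilityMeasure ν := by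
    constructor
    rw [hν, withDensity_apply _ MeasurableSet.univ, Measure.restrict_univ,
      ← ofReal_integral_eq_lintegral_ofReal (hwi.const_mul _) (Eventually.of_forall fun v => mul_nonneg (by positivity) (hw0 v)),
      integral_const_mul, ← hC, inv_mul_cancel₀ hC0.ne', ENNReal.ofReal_one]
  have hK := pd_kernel_integral ν (fun x y => h (x - y)) (by fun_prop) B (fun x y => hB _) hpos
  have hint : Integrable (fun p : V × V => h (p.1 - p.2)) (ν.prod ν) :=
    Integrable.of_bound (by fun_prop) B (Eventually.of_forall fun x => hB _)
  rw [integral_prod_symm _ hint] at hK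
  have hdens : ∀ q : V → ℝ, ∫ v, q v ∂ν = C⁻¹ * ∫ v, w v * q v := by
    intro q
    rw [hν, integral_withDensity_eq_integral_toReal_smul (by fun_prop) (by simp), ← integral_const_mul]
    congr 1; ext v
    rw [ENNReal.toReal_ofReal (mul_nonneg (by positivity) (hw0 v)), smul_eq_mul, mul_assoc]
  simp only [hdens] at hK
  have h1 : 0 ≤ ∫ v, ∫ u, w v * (w (u + v) * h u) := by
    have e : ∀ y : V, w y * (C⁻¹ * ∫ v, w v * h (v - y)) = C⁻¹ * ∫ u, w y * (w (u + y) * h u) := by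
      intro y
      rw [integral_const_mul]
      have := integral_add_right_eq_self (μ := (volume : Measure V)) (fun v => w v * h (v - y)) y
      simp only [add_sub_cancel_right] at this
      rw [this]; ring
    simp only [e] at hK
    rw [integral_const_mul, ← mul_assoc] at hK
    exact nonneg_of_mul_nonneg_right hK (by positivity)
  have hI2 : Integrable (fun p : V × V => w p.1 * (w (p.2 + p.1) * h p.2)) (volume.prod volume) := by
    have hb : Integrable (fun p : V × V => B * (Real.exp (-(2 * ε / 3) * ‖p.1‖ ^ 2) * Real.exp (-(2 * ε / 3) * ‖p.2‖ ^ 2))) (volume.prod volume) :=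
      (Integrable.mul_prod (integrable_gauss _ (by positivity)) (integrable_gauss _ (by positivity))).const_mul B
    apply hb.mono' (by fun_prop)
    refine Eventually.of_forall fun p => ?_
    rw [Real.norm_eq_abs, abs_mul, abs_mul, abs_of_nonneg (hw0 _), abs_of_nonneg (hw0 _), ← mul_assoc, mul_comm B]
    refine mul_le_mul ?_ (hB _) (abs_nonneg _) (by positivity)
    rw [← Real.exp_add, ← Real.exp_add]
    apply Real.exp_le_exp.mpr
    have h3 : ‖p.2‖ ≤ ‖p.2 + p.1‖ + ‖p.1‖ := by
      simpa using norm_sub_le (p.2 + p.1) p.1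
    have h4 : ‖p.2‖ ^ 2 ≤ 2 * ‖p.2 + p.1‖ ^ 2 + 2 * ‖p.1‖ ^ 2 := by
      have := norm_nonneg p.2
      nlinarith [sq_nonneg (‖p.2 + p.1‖ - ‖p.1‖)]
    nlinarith [sq_nonneg ‖p.2 + p.1‖]
  rw [integral_integral_swap (f := fun v u => w v * (w (u + v) * h u)) hI2] at h1
  have h5 : ∀ u : V, ∫ v, w v * (w (u + v) * h u) = (h u * Real.exp (-ε * ‖u‖ ^ 2)) * ∫ v : V, Real.exp (-(4 * ε) * ‖v‖ ^ 2) := by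
    intro u
    rw [← integral_add_right_eq_self (μ := (volume : Measure V)) (fun v => Real.exp (-(4 * ε) * ‖v‖ ^ 2)) ((2 : ℝ)⁻¹ • u), ← integral_const_mul]
    congr 1; ext v
    have e : w v * w (u + v) = Real.exp (-ε * ‖u‖ ^ 2) * Real.exp (-(4 * ε) * ‖v + (2 : ℝ)⁻¹ • u‖ ^ 2) := by
      simp only [hw]
      rw [← Real.exp_add, ← Real.exp_add]
      congr 1
      rw [@norm_add_sq_real V, @norm_add_sq_real V, norm_smul, inner_smul_right, real_inner_comm u v]
      norm_num
      ring
    rw [← mul_assoc, e]; ring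
  simp only [h5] at h1
  rw [integral_mul_const] at h1
  exact nonneg_of_mul_nonneg_left h1 (gauss_pos (4 * ε) (by positivity))

end gauss

section gauss2
variable {V : Type*} [NormedAddCommGroup V] [InnerProductSpace ℝ V] [FiniteDimensional ℝ V]
  [MeasurableSpace V] [BorelSpace V]

open scoped FourierTransform Topology

/-- the spectral density of the damped radial function -/
def specDens (f : ℝ → ℝ) (ε : ℝ) (y : V) : ℝ :=
  ∫ u : V, (Real.cos (2 * Real.pi * ⟪u, y⟫) * f ‖u‖) * Real.exp (-ε * ‖u‖ ^ 2)

lemma integrable_bdd_gauss (h : V → ℝ) (hc : Continuous h) (B : ℝ) (hB : ∀ x, |h x| ≤ B) (ε : ℝ) (hε : 0 < ε) :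
    Integrable (fun u => h u * Real.exp (-ε * ‖u‖ ^ 2)) :=
  (integrable_gauss ε hε).bdd_mul hc.aestronglyMeasurable (Eventually.of_forall hB)

lemma specDens_comp (f : ℝ → ℝ) (ε : ℝ) (R : V ≃ₗᵢ[ℝ] V) (y : V) : specDens f ε (R y) = specDens f ε y := by
  unfold specDens
  rw [← R.measurePreserving.integral_comp' (f := R.toMeasurableEquiv)]
  simp

lemma fourier_damped (f : ℝ → ℝ) (hfc : Continuous (fun x : V => f ‖x‖)) (B : ℝ) (hB : ∀ x : V, |f ‖x‖| ≤ B)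
    (ε : ℝ) (hε : 0 < ε) (y : V) :
    𝓕 (fun x : V => ((f ‖x‖ * Real.exp (-ε * ‖x‖ ^ 2) : ℝ) : ℂ)) y = (specDens f ε y : ℂ) := by
  have hint : Integrable (fun x : V => ((f ‖x‖ * Real.exp (-ε * ‖x‖ ^ 2) : ℝ) : ℂ)) :=
    (integrable_bdd_gauss (fun x : V => f ‖x‖) hfc B hB ε hε).ofReal
  have hi2 : Integrable (fun v : V => Complex.exp (((-2 * Real.pi * ⟪v, y⟫ : ℝ) : ℂ) * Complex.I) • ((f ‖v‖ * Real.exp (-ε * ‖v‖ ^ 2) : ℝ) : ℂ)) := by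
    apply hint.bdd_mul (c := 1) (Continuous.aestronglyMeasurable (by fun_prop))
    exact Eventually.of_forall fun v => (Complex.norm_exp_ofReal_mul_I _).le
  rw [Real.fourier_eq']
  apply Complex.ext
  · rw [Complex.ofReal_re, ← RCLike.re_eq_complex_re, ← integral_re hi2]
    unfold specDens
    congr 1; ext v
    rw [RCLike.re_eq_complex_re, smul_eq_mul, Complex.re_mul_ofReal, Complex.exp_ofReal_mul_I_re,
      show -2 * Real.pi * ⟪v, y⟫ = -(2 * Real.pi * ⟪v, y⟫) by ring, Real.cos_neg]
    ring
  · rw [Complex.ofReal_im, ← RCLike.im_eq_complex_im, ← integral_im hi2]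
    have h := integral_neg_eq_self (fun v : V => RCLike.im (Complex.exp (((-2 * Real.pi * ⟪v, y⟫ : ℝ) : ℂ) * Complex.I) • ((f ‖v‖ * Real.exp (-ε * ‖v‖ ^ 2) : ℝ) : ℂ))) volume
    have h2 : ∀ v : V, RCLike.im (Complex.exp (((-2 * Real.pi * ⟪-v, y⟫ : ℝ) : ℂ) * Complex.I) • ((f ‖-v‖ * Real.exp (-ε * ‖-v‖ ^ 2) : ℝ) : ℂ))
      = - RCLike.im (Complex.exp (((-2 * Real.pi * ⟪v, y⟫ : ℝ) : ℂ) * Complex.I) • ((f ‖v‖ * Real.exp (-ε * ‖v‖ ^ 2) : ℝ) : ℂ)) := by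
      intro v
      rw [RCLike.im_eq_complex_im, smul_eq_mul, smul_eq_mul, Complex.im_mul_ofReal, Complex.im_mul_ofReal,
        Complex.exp_ofReal_mul_I_im, Complex.exp_ofReal_mul_I_im, inner_neg_left, norm_neg, mul_neg, Real.sin_neg]
      ring
    simp only [h2] at h
    rw [integral_neg] at h
    linarith

lemma specDens_continuous (f : ℝ → ℝ) (hfc : Continuous (fun x : V => f ‖x‖)) (B : ℝ) (hB : ∀ x : V, |f ‖x‖| ≤ B)
    (ε : ℝ) (hε : 0 < ε) : Continuous (specDens f ε : V → ℝ) := by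
  have hint : Integrable (fun x : V => ((f ‖x‖ * Real.exp (-ε * ‖x‖ ^ 2) : ℝ) : ℂ)) :=
    (integrable_bdd_gauss (fun x : V => f ‖x‖) hfc B hB ε hε).ofReal
  have h1 : Continuous (𝓕 (fun x : V => ((f ‖x‖ * Real.exp (-ε * ‖x‖ ^ 2) : ℝ) : ℂ))) :=
    VectorFourier.fourierIntegral_continuous Real.continuous_fourierChar continuous_inner hint
  have h2 : (specDens f ε : V → ℝ) = fun y => (𝓕 (fun x : V => ((f ‖x‖ * Real.exp (-ε * ‖x‖ ^ 2) : ℝ) : ℂ)) y).re := by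
    ext y
    rw [fourier_damped f hfc B hB ε hε, Complex.ofReal_re]
  rw [h2]
  fun_prop

lemma specDens_bdd (f : ℝ → ℝ) (hfc : Continuous (fun x : V => f ‖x‖)) (B : ℝ) (hB : ∀ x : V, |f ‖x‖| ≤ B)
    (ε : ℝ) (hε : 0 < ε) : ∃ M, ∀ y : V, |specDens f ε y| ≤ M := by
  refine ⟨∫ u : V, |f ‖u‖ * Real.exp (-ε * ‖u‖ ^ 2)|, fun y => ?_⟩
  unfold specDens
  refine (abs_integral_le_integral_abs).trans ?_
  have h1 := integrable_bdd_gauss (fun x : V => f ‖x‖) hfc B hB ε hε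
  have h2 : ∀ u : V, |Real.cos (2 * Real.pi * ⟪u, y⟫) * f ‖u‖ * Real.exp (-ε * ‖u‖ ^ 2)| ≤ |f ‖u‖ * Real.exp (-ε * ‖u‖ ^ 2)| := by
    intro u
    rw [mul_assoc, abs_mul]
    exact mul_le_of_le_one_left (abs_nonneg _) (Real.abs_cos_le_one _)
  refine integral_mono_of_nonneg (Eventually.of_forall fun u => abs_nonneg _) h1.abs (Eventually.of_forall h2)

lemma specDens_inv (f : ℝ → ℝ) (hfc : Continuous (fun x : V => f ‖x‖)) (B : ℝ) (hB : ∀ x : V, |f ‖x‖| ≤ B)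
    (ε : ℝ) (hε : 0 < ε) (v : V) :
    Tendsto (fun c : ℝ => ∫ w : V, Complex.exp (((2 * Real.pi * ⟪v, w⟫ : ℝ) : ℂ) * Complex.I) *
      ((Real.exp (-c⁻¹ * ‖w‖ ^ 2) * specDens f ε w : ℝ) : ℂ)) atTop
      (𝓝 ((f ‖v‖ * Real.exp (-ε * ‖v‖ ^ 2) : ℝ) : ℂ)) := by
  set g : V → ℂ := (fun x : V => ((f ‖x‖ * Real.exp (-ε * ‖x‖ ^ 2) : ℝ) : ℂ)) with hg
  have hint : Integrable g :=
    (integrable_bdd_gauss (fun x : V => f ‖x‖) hfc B hB ε hε).ofReal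
  have hgc : Continuous g := Complex.continuous_ofReal.comp (hfc.mul (by fun_prop))
  have h1 := Real.tendsto_integral_gaussian_smul' hint (v := v) hgc.continuousAt
  refine h1.congr' ?_
  filter_upwards [Ioi_mem_atTop 0] with c (hc : 0 < c)
  have J : Integrable (fun w : V ↦ Complex.exp (- (c : ℂ)⁻¹ * ‖w‖ ^ 2 + 2 * Real.pi * Complex.I * ⟪v, w⟫)) :=
      GaussianFourier.integrable_cexp_neg_mul_sq_norm_add (by simpa) _ _
  have h2 : (∫ w : V, (𝓕 (fun w : V ↦ Complex.exp (- (c : ℂ)⁻¹ * ‖w‖ ^ 2 + 2 * Real.pi * Complex.I * ⟪v, w⟫)) w) • g w)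
     = ∫ w : V, Complex.exp (- (c : ℂ)⁻¹ * ‖w‖ ^ 2 + 2 * Real.pi * Complex.I * ⟪v, w⟫) • 𝓕 g w := by
    simpa using! (VectorFourier.integral_fourierIntegral_smul_eq_flip (L := innerₗ V)
      Real.continuous_fourierChar continuous_inner J hint)
  have h3 : (∫ w : V, Complex.exp (- (c : ℂ)⁻¹ * ‖w‖ ^ 2 + 2 * Real.pi * Complex.I * ⟪v, w⟫) • 𝓕 g w) = ∫ w : V, Complex.exp (((2 * Real.pi * ⟪v, w⟫ : ℝ) : ℂ) * Complex.I) *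
      ((Real.exp (-c⁻¹ * ‖w‖ ^ 2) * specDens f ε w : ℝ) : ℂ) := by
    congr 1; ext w
    rw [hg, fourier_damped f hfc B hB ε hε, smul_eq_mul, Complex.exp_add]
    push_cast
    rw [show (2 * (Real.pi : ℂ) * Complex.I * ((⟪v, w⟫ : ℝ) : ℂ)) = 2 * (Real.pi : ℂ) * ((⟪v, w⟫ : ℝ) : ℂ) * Complex.I by ring]
    ring
  rw [← h3, ← h2]
  congr with w
  rw [fourier_gaussian_innerProductSpace' (by simpa)]
  have e1 : ((Real.pi : ℂ) / (c : ℂ)⁻¹) = Real.pi * c := by simp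
  have e2 : -(Real.pi : ℂ) ^ 2 * ↑‖v - w‖ ^ 2 / (c : ℂ)⁻¹ = -(Real.pi : ℂ) ^ 2 * c * ↑‖v - w‖ ^ 2 := by
    rw [div_inv_eq_mul]; ring
  rw [e1, e2]

end gauss2

section rotation
open scoped Topology

variable {n : ℕ}

/-- rotation in the plane of coordinates `i0`, `l` -/
def rotFun (i0 l : Fin n) (θ : ℝ) (y : EuclideanSpace ℝ (Fin n)) : EuclideanSpace ℝ (Fin n) :=
  y + (((Real.cos θ - 1) * y i0 - Real.sin θ * y l) • EuclideanSpace.single i0 (1 : ℝ)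
    + ((Real.cos θ - 1) * y l + Real.sin θ * y i0) • EuclideanSpace.single l (1 : ℝ))

lemma rotFun_equiv (i0 l : Fin n) (hil : i0 ≠ l) (θ : ℝ) :
    ∃ e : EuclideanSpace ℝ (Fin n) ≃ₗᵢ[ℝ] EuclideanSpace ℝ (Fin n), ∀ y, e y = rotFun i0 l θ y := by
  let L : EuclideanSpace ℝ (Fin n) →ₗ[ℝ] EuclideanSpace ℝ (Fin n) :=
    { toFun := rotFun i0 l θ
      map_add' := by
        intro x y
        unfold rotFun
        simp only [PiLp.add_apply]
        module
      map_smul' := by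
        intro r x
        unfold rotFun
        simp only [PiLp.smul_apply, smul_eq_mul, RingHom.id_apply]
        module }
  have hn : ∀ y, ‖L y‖ = ‖y‖ := by
    intro y
    have : ‖rotFun i0 l θ y‖ ^ 2 = ‖y‖ ^ 2 := by
      unfold rotFun
      rw [@norm_add_sq_real (EuclideanSpace ℝ (Fin n)), @norm_add_sq_real (EuclideanSpace ℝ (Fin n))]
      simp only [inner_add_right, inner_smul_right, inner_smul_left, norm_smul, EuclideanSpace.norm_single,
        EuclideanSpace.inner_single_left, EuclideanSpace.inner_single_right]
      simp [hil, Ne.symm hil]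
      have := Real.sin_sq_add_cos_sq θ
      have h2 : Real.sin θ ^ 2 = 1 - Real.cos θ ^ 2 := by linarith
      ring_nf
      rw [h2]
      ring
    exact (pow_left_inj₀ (norm_nonneg _) (norm_nonneg _) two_ne_zero).mp this
  let Li : EuclideanSpace ℝ (Fin n) →ₗᵢ[ℝ] EuclideanSpace ℝ (Fin n) := ⟨L, hn⟩
  exact ⟨Li.toLinearIsometryEquiv rfl, fun y => rfl⟩

lemma rotFun_continuous (i0 l : Fin n) :
    Continuous (fun p : ℝ × EuclideanSpace ℝ (Fin n) => rotFun i0 l p.1 p.2) := by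
  unfold rotFun
  fun_prop

/-- exponential sum -/
def expSum (s : Finset ℕ) (X : ℕ → EuclideanSpace ℝ (Fin n)) (ξ : ℕ → ℂ) (y : EuclideanSpace ℝ (Fin n)) : ℂ :=
  ∑ k ∈ s, ξ k * Complex.exp (((2 * Real.pi * ⟪X k, y⟫ : ℝ) : ℂ) * Complex.I)

lemma expSum_rot (s : Finset ℕ) (X : ℕ → EuclideanSpace ℝ (Fin n)) (i0 l : Fin n) (hX : ∀ k, X k i0 = 0)
    (ξ : ℕ → ℂ) (y : EuclideanSpace ℝ (Fin n)) (θ : ℝ) :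
    expSum s X ξ (rotFun i0 l θ y) = ∑ k ∈ s,
      (ξ k * Complex.exp (((2 * Real.pi * (⟪X k, y⟫ - X k l * y l) : ℝ) : ℂ) * Complex.I)) *
        Complex.exp (((2 * Real.pi * X k l * (Real.cos θ * y l + Real.sin θ * y i0) : ℝ) : ℂ) * Complex.I) := by
  unfold expSum
  apply Finset.sum_congr rfl
  intro k _
  rw [mul_assoc (ξ k), ← Complex.exp_add, ← add_mul, ← Complex.ofReal_add]
  congr 4
  unfold rotFun
  simp only [inner_add_right, inner_smul_right, EuclideanSpace.inner_single_right]
  simp [hX]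
  ring

lemma rot_lower (s : Finset ℕ) (X : ℕ → EuclideanSpace ℝ (Fin n)) (i0 l : Fin n) (hX : ∀ k, X k i0 = 0)
    (a c : ℝ) (ha : 0 < a) (hc : 0 < c)
    (H : ∀ (ξ : ℕ → ℂ), c * ∑ k ∈ s, ‖ξ k‖ ^ 2 ≤ ∫ t in (-a)..a, ‖∑ j ∈ s, ξ j * Complex.exp (((2 * Real.pi * X j l * t : ℝ) : ℂ) * Complex.I)‖ ^ 2)
    (s0 κ : ℝ) (hκ : 0 ≤ κ) (hs : (2 * Real.pi * s0 * a) ^ 2 / 2 ≤ κ)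
    (ξ : ℕ → ℂ) (y : EuclideanSpace ℝ (Fin n)) :
    (c / (4 * a) * ∑ k ∈ s, ‖ξ k‖ ^ 2) * (1 - κ - Real.cos (2 * Real.pi * s0 * y i0)) ≤
      ∫ θ in (0 : ℝ)..(2 * Real.pi), ‖expSum s X ξ (rotFun i0 l θ y)‖ ^ 2 := by
  have hS : 0 ≤ c / (4 * a) * ∑ k ∈ s, ‖ξ k‖ ^ 2 := by positivity
  set ρ := Real.sqrt ((y l) ^ 2 + (y i0) ^ 2) with hρ
  have hρ2 : (y l) ^ 2 + (y i0) ^ 2 = ρ ^ 2 := (Real.sq_sqrt (by positivity)).symm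
  rcases lt_or_ge ρ a with h | h
  · have h0 : 0 ≤ ∫ θ in (0 : ℝ)..(2 * Real.pi), ‖expSum s X ξ (rotFun i0 l θ y)‖ ^ 2 :=
      intervalIntegral.integral_nonneg (by positivity) (fun θ _ => by positivity)
    refine le_trans ?_ h0
    apply mul_nonpos_of_nonneg_of_nonpos hS
    have h1 := Real.one_sub_sq_div_two_le_cos (x := 2 * Real.pi * s0 * y i0)
    have h2 : (y i0) ^ 2 ≤ a ^ 2 := by
      have : 0 ≤ ρ := Real.sqrt_nonneg _
      nlinarith [sq_nonneg (y l)]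
    have h3 : (2 * Real.pi * s0 * y i0) ^ 2 ≤ (2 * Real.pi * s0 * a) ^ 2 := by
      rw [mul_pow, mul_pow _ a]; gcongr
    linarith
  · set ξ' : ℕ → ℂ := fun k => ξ k * Complex.exp (((2 * Real.pi * (⟪X k, y⟫ - X k l * y l) : ℝ) : ℂ) * Complex.I) with hξ'
    have h3 : ∀ j, ‖ξ' j‖ = ‖ξ j‖ := by
      intro j
      rw [hξ', norm_mul, Complex.norm_exp_ofReal_mul_I, mul_one]
    have h1 := long_interval' s (fun k => X k l) a c ha hc H ξ' ρ h
    have h2 := circle_avg (fun t => ‖∑ j ∈ s, ξ' j * Complex.exp (((2 * Real.pi * X j l * t : ℝ) : ℂ) * Complex.I)‖ ^ 2)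
      (by fun_prop) (fun t => by positivity) (y l) (y i0) ρ (ha.trans_le h) hρ2
    simp only [h3] at h1
    have h4 := h1.trans h2
    simp only [expSum_rot s X i0 l hX]
    refine le_trans ?_ h4
    have h5 := Real.neg_one_le_cos (2 * Real.pi * s0 * y i0)
    calc _ ≤ (c / (4 * a) * ∑ k ∈ s, ‖ξ k‖ ^ 2) * 2 := by
          apply mul_le_mul_of_nonneg_left _ hS; linarith
      _ = _ := by field_simp; ring

lemma expSum_continuous (s : Finset ℕ) (X : ℕ → EuclideanSpace ℝ (Fin n)) (ξ : ℕ → ℂ) : Continuous (expSum s X ξ) := by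
  unfold expSum; fun_prop

lemma expSum_bound (s : Finset ℕ) (X : ℕ → EuclideanSpace ℝ (Fin n)) (ξ : ℕ → ℂ) (y) : ‖expSum s X ξ y‖ ≤ ∑ k ∈ s, ‖ξ k‖ := by
  unfold expSum
  refine (norm_sum_le _ _).trans (Finset.sum_le_sum fun k _ => ?_)
  rw [norm_mul, Complex.norm_exp_ofReal_mul_I, mul_one]

lemma rot_avg (s : Finset ℕ) (X : ℕ → EuclideanSpace ℝ (Fin n)) (i0 l : Fin n) (hil : i0 ≠ l) (hX : ∀ k, X k i0 = 0)
    (a c : ℝ) (ha : 0 < a) (hc : 0 < c)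
    (H : ∀ (ξ : ℕ → ℂ), c * ∑ k ∈ s, ‖ξ k‖ ^ 2 ≤ ∫ t in (-a)..a, ‖∑ j ∈ s, ξ j * Complex.exp (((2 * Real.pi * X j l * t : ℝ) : ℂ) * Complex.I)‖ ^ 2)
    (s0 κ : ℝ) (hκ : 0 ≤ κ) (hs : (2 * Real.pi * s0 * a) ^ 2 / 2 ≤ κ)
    (ξ : ℕ → ℂ) (m : EuclideanSpace ℝ (Fin n) → ℝ) (hmc : Continuous m) (hmi : Integrable m)
    (hm0 : ∀ y, 0 ≤ m y) (hmR : ∀ (R : EuclideanSpace ℝ (Fin n) ≃ₗᵢ[ℝ] EuclideanSpace ℝ (Fin n)) y, m (R y) = m y) :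
    (c / (4 * a) * ∑ k ∈ s, ‖ξ k‖ ^ 2) * (∫ y, (1 - κ - Real.cos (2 * Real.pi * s0 * y i0)) * m y) ≤
      2 * Real.pi * ∫ y, ‖expSum s X ξ y‖ ^ 2 * m y := by
  have hpi := Real.pi_pos
  have hθ : ∀ θ, ∫ y, ‖expSum s X ξ (rotFun i0 l θ y)‖ ^ 2 * m y = ∫ y, ‖expSum s X ξ y‖ ^ 2 * m y := by
    intro θ
    obtain ⟨e, he⟩ := rotFun_equiv i0 l hil θ
    have h1 := e.measurePreserving.integral_comp' (f := e.toMeasurableEquiv) (fun y => ‖expSum s X ξ y‖ ^ 2 * m y)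
    rw [← h1]
    congr 1; ext y
    change _ = ‖expSum s X ξ (e y)‖ ^ 2 * m (e y)
    rw [hmR, he]
  have hFc := expSum_continuous s X ξ
  have hRc := rotFun_continuous i0 l
  set Sξ := ∑ k ∈ s, ‖ξ k‖ with hSξ
  have hI : Integrable (fun p : ℝ × EuclideanSpace ℝ (Fin n) => ‖expSum s X ξ (rotFun i0 l p.1 p.2)‖ ^ 2 * m p.2)
      ((volume.restrict (Set.Ioc 0 (2 * Real.pi))).prod volume) := by
    have h1 : Integrable (fun p : ℝ × EuclideanSpace ℝ (Fin n) => Sξ ^ 2 * m p.2)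
      ((volume.restrict (Set.Ioc 0 (2 * Real.pi))).prod volume) :=
      Integrable.mul_prod (f := fun _ : ℝ => Sξ ^ 2) (integrable_const _) hmi
    apply h1.mono'
    · apply Continuous.aestronglyMeasurable
      fun_prop
    · refine Eventually.of_forall fun p => ?_
      rw [norm_mul, Real.norm_of_nonneg (hm0 _), norm_pow, norm_norm]
      have := expSum_bound s X ξ (rotFun i0 l p.1 p.2)
      have := hm0 p.2
      gcongr
  have h1 : 2 * Real.pi * ∫ y, ‖expSum s X ξ y‖ ^ 2 * m y =
      ∫ y, (∫ θ in (0 : ℝ)..(2 * Real.pi), ‖expSum s X ξ (rotFun i0 l θ y)‖ ^ 2) * m y := by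
    have h2 := integral_integral_swap (f := fun θ y => ‖expSum s X ξ (rotFun i0 l θ y)‖ ^ 2 * m y) hI
    simp only [hθ] at h2
    rw [integral_const] at h2
    simp only [intervalIntegral.integral_of_le (show (0 : ℝ) ≤ 2 * Real.pi by positivity)]
    simp only [integral_mul_const] at h2
    rw [← h2]
    simp [hpi.le]
  have hI2 : Integrable (fun y => (∫ θ in (0 : ℝ)..(2 * Real.pi), ‖expSum s X ξ (rotFun i0 l θ y)‖ ^ 2) * m y) := by
    have := hI.integral_prod_right
    simp only [integral_mul_const] at this
    simpa only [intervalIntegral.integral_of_le (show (0 : ℝ) ≤ 2 * Real.pi by positivity)] using this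
  rw [h1, ← integral_const_mul]
  apply integral_mono _ hI2
  · intro y
    have := rot_lower s X i0 l hX a c ha hc H s0 κ hκ hs ξ y
    simp only
    rw [← mul_assoc]
    exact mul_le_mul_of_nonneg_right this (hm0 y)
  · apply Integrable.const_mul
    apply hmi.bdd_mul (c := 2 + κ)
    · exact Continuous.aestronglyMeasurable (by fun_prop)
    · refine Eventually.of_forall fun y => ?_
      rw [Real.norm_eq_abs, abs_le]
      have h5 := Real.neg_one_le_cos (2 * Real.pi * s0 * y i0)
      have h6 := Real.cos_le_one (2 * Real.pi * s0 * y i0)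
      constructor <;> linarith

end rotation

section final
open scoped Topology

variable {n : ℕ}

lemma quad_form (s : Finset ℕ) (X : ℕ → EuclideanSpace ℝ (Fin n)) (ξ : ℕ → ℂ) (m : EuclideanSpace ℝ (Fin n) → ℝ)
    (hmi : Integrable m) :
    ((∫ y, ‖expSum s X ξ y‖ ^ 2 * m y : ℝ) : ℂ) = ∑ j ∈ s, ∑ k ∈ s, ξ k * (starRingEnd ℂ) (ξ j) *
      ∫ w, Complex.exp (((2 * Real.pi * ⟪X k - X j, w⟫ : ℝ) : ℂ) * Complex.I) * (m w : ℂ) := by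
  rw [← integral_complex_ofReal]
  have hint : ∀ j k, Integrable (fun w => ξ k * (starRingEnd ℂ) (ξ j) *
      (Complex.exp (((2 * Real.pi * ⟪X k - X j, w⟫ : ℝ) : ℂ) * Complex.I) * (m w : ℂ))) := by
    intro j k
    apply Integrable.const_mul
    apply hmi.ofReal.bdd_mul (c := 1) (Continuous.aestronglyMeasurable (by fun_prop))
    exact Eventually.of_forall fun v => (Complex.norm_exp_ofReal_mul_I _).le
  simp only [← integral_const_mul]
  simp_rw [← integral_finsetSum s (fun k _ => hint _ k)]
  rw [← integral_finsetSum s (fun j _ => integrable_finsetSum s (fun k _ => hint j k))]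
  congr 1; ext y
  push_cast
  rw [← Complex.mul_conj']
  unfold expSum
  rw [map_sum, Finset.sum_mul_sum, Finset.sum_comm, Finset.sum_mul]
  apply Finset.sum_congr rfl; intro j _
  rw [Finset.sum_mul]
  apply Finset.sum_congr rfl; intro k _
  have e : Complex.exp (2 * (Real.pi : ℂ) * ((⟪X k - X j, y⟫ : ℝ) : ℂ) * Complex.I) =
     Complex.exp (((2 * Real.pi * ⟪X k, y⟫ : ℝ) : ℂ) * Complex.I) * (starRingEnd ℂ) (Complex.exp (((2 * Real.pi * ⟪X j, y⟫ : ℝ) : ℂ) * Complex.I)) := by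
    rw [← Complex.exp_conj, ← Complex.exp_add, map_mul, Complex.conj_ofReal, Complex.conj_I, inner_sub_left]
    congr 1
    push_cast; ring
  rw [e, map_mul]; ring

lemma main_eps (f : ℝ → ℝ) (hfc : Continuous (fun x : EuclideanSpace ℝ (Fin n) => f ‖x‖)) (B : ℝ)
    (hB : ∀ x : EuclideanSpace ℝ (Fin n), |f ‖x‖| ≤ B) (ε : ℝ) (hε : 0 < ε)
    (hp : ∀ y : EuclideanSpace ℝ (Fin n), 0 ≤ specDens f ε y)
    (s : Finset ℕ) (X : ℕ → EuclideanSpace ℝ (Fin n)) (i0 l : Fin n) (hil : i0 ≠ l) (hX : ∀ k, X k i0 = 0)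
    (a c : ℝ) (ha : 0 < a) (hc : 0 < c)
    (H : ∀ (ξ : ℕ → ℂ), c * ∑ k ∈ s, ‖ξ k‖ ^ 2 ≤ ∫ t in (-a)..a, ‖∑ j ∈ s, ξ j * Complex.exp (((2 * Real.pi * X j l * t : ℝ) : ℂ) * Complex.I)‖ ^ 2)
    (s0 κ : ℝ) (hs0 : 0 ≤ s0) (hκ : 0 ≤ κ) (hs : (2 * Real.pi * s0 * a) ^ 2 / 2 ≤ κ) (ξ : ℕ → ℂ) :
    (c / (4 * a) * ∑ k ∈ s, ‖ξ k‖ ^ 2) * ((1 - κ) * f 0 - f s0 * Real.exp (-ε * s0 ^ 2)) ≤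
      2 * Real.pi * (∑ j ∈ s, ∑ k ∈ s, ξ k * (starRingEnd ℂ) (ξ j) *
        ((f ‖X k - X j‖ * Real.exp (-ε * ‖X k - X j‖ ^ 2) : ℝ) : ℂ)).re := by
  set m : ℝ → EuclideanSpace ℝ (Fin n) → ℝ := fun r w => Real.exp (-r⁻¹ * ‖w‖ ^ 2) * specDens f ε w with hm
  have hmc : ∀ r, Continuous (m r) := by
    intro r
    have := specDens_continuous f hfc B hB ε hε
    simp only [hm]
    fun_prop
  obtain ⟨M, hM⟩ := specDens_bdd f hfc B hB ε hε
  have hmi : ∀ r, 0 < r → Integrable (m r) := by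
    intro r hr
    have := integrable_bdd_gauss (specDens f ε) (specDens_continuous f hfc B hB ε hε) M hM r⁻¹ (by positivity)
    exact this.congr (Eventually.of_forall fun w => mul_comm _ _)
  have hm0 : ∀ r y, 0 ≤ m r y := fun r y => mul_nonneg (Real.exp_pos _).le (hp y)
  have hmR : ∀ r (R : EuclideanSpace ℝ (Fin n) ≃ₗᵢ[ℝ] EuclideanSpace ℝ (Fin n)) y, m r (R y) = m r y := by
    intro r R y
    simp only [hm, specDens_comp, R.norm_map]
  have hinv := specDens_inv f hfc B hB ε hε
  -- right-hand side
  have hR : Tendsto (fun r => 2 * Real.pi * ∫ y, ‖expSum s X ξ y‖ ^ 2 * m r y) atTop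
      (𝓝 (2 * Real.pi * (∑ j ∈ s, ∑ k ∈ s, ξ k * (starRingEnd ℂ) (ξ j) *
        ((f ‖X k - X j‖ * Real.exp (-ε * ‖X k - X j‖ ^ 2) : ℝ) : ℂ)).re)) := by
    apply Tendsto.const_mul
    have h1 : Tendsto (fun r => (∑ j ∈ s, ∑ k ∈ s, ξ k * (starRingEnd ℂ) (ξ j) *
      ∫ w, Complex.exp (((2 * Real.pi * ⟪X k - X j, w⟫ : ℝ) : ℂ) * Complex.I) * (m r w : ℂ))) atTop
      (𝓝 (∑ j ∈ s, ∑ k ∈ s, ξ k * (starRingEnd ℂ) (ξ j) *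
        ((f ‖X k - X j‖ * Real.exp (-ε * ‖X k - X j‖ ^ 2) : ℝ) : ℂ))) :=
      tendsto_finsetSum _ fun j _ => tendsto_finsetSum _ fun k _ => (hinv (X k - X j)).const_mul _
    refine ((Complex.continuous_re.tendsto _).comp h1).congr' ?_
    filter_upwards [Ioi_mem_atTop 0] with r (hr : 0 < r)
    simp only [Function.comp]
    rw [← quad_form s X ξ (m r) (hmi r hr), Complex.ofReal_re]
  have hcos : ∀ (v : EuclideanSpace ℝ (Fin n)), Tendsto (fun r => ∫ w, Real.cos (2 * Real.pi * ⟪v, w⟫) * m r w) atTop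
      (𝓝 (f ‖v‖ * Real.exp (-ε * ‖v‖ ^ 2))) := by
    intro v
    have h1 := (Complex.continuous_re.tendsto _).comp (hinv v)
    rw [Complex.ofReal_re] at h1
    refine h1.congr' ?_
    filter_upwards [Ioi_mem_atTop 0] with r (hr : 0 < r)
    simp only [Function.comp]
    have hi : Integrable (fun w => Complex.exp (((2 * Real.pi * ⟪v, w⟫ : ℝ) : ℂ) * Complex.I) * (m r w : ℂ)) := by
      apply (hmi r hr).ofReal.bdd_mul (c := 1) (Continuous.aestronglyMeasurable (by fun_prop))
      exact Eventually.of_forall fun v => (Complex.norm_exp_ofReal_mul_I _).le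
    have h2 := integral_re hi
    simp only [RCLike.re_eq_complex_re, Complex.re_mul_ofReal, Complex.exp_ofReal_mul_I_re] at h2
    exact h2.symm
  have hL : Tendsto (fun r => (c / (4 * a) * ∑ k ∈ s, ‖ξ k‖ ^ 2) * (∫ y, (1 - κ - Real.cos (2 * Real.pi * s0 * y i0)) * m r y)) atTop
      (𝓝 ((c / (4 * a) * ∑ k ∈ s, ‖ξ k‖ ^ 2) * ((1 - κ) * f 0 - f s0 * Real.exp (-ε * s0 ^ 2)))) := by
    apply Tendsto.const_mul
    have h0 := hcos 0
    have h1 := hcos (s0 • EuclideanSpace.single i0 (1 : ℝ))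
    have hn : ‖s0 • EuclideanSpace.single i0 (1 : ℝ)‖ = s0 := by
      rw [norm_smul, PiLp.norm_single]; simp [hs0]
    rw [hn] at h1
    simp only [norm_zero, inner_zero_left, mul_zero, Real.cos_zero, one_mul] at h0
    have h0' : Tendsto (fun r => ∫ w, m r w) atTop (𝓝 (f 0)) := by simpa using h0
    have h3 : ∀ w : EuclideanSpace ℝ (Fin n), ⟪s0 • EuclideanSpace.single i0 (1 : ℝ), w⟫ = s0 * w i0 := by
      intro w
      rw [real_inner_smul_left, EuclideanSpace.inner_single_left]; simp
    simp only [h3] at h1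
    refine ((h0'.const_mul (1 - κ)).sub h1).congr' ?_
    filter_upwards [Ioi_mem_atTop 0] with r (hr : 0 < r)
    rw [← integral_const_mul, ← integral_sub ((hmi r hr).const_mul _)]
    · congr 1; ext y
      rw [mul_assoc (2 * Real.pi)]
      ring
    · apply (hmi r hr).bdd_mul (c := 1) (Continuous.aestronglyMeasurable (by fun_prop))
      exact Eventually.of_forall fun v => Real.abs_cos_le_one _
  refine le_of_tendsto_of_tendsto hL hR ?_
  filter_upwards [Ioi_mem_atTop 0] with r (hr : 0 < r)
  exact rot_avg s X i0 l hil hX a c ha hc H s0 κ hκ hs ξ (m r) (hmc r) (hmi r hr) (hm0 r) (hmR r)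

lemma main_zero (f : ℝ → ℝ) (hfc : Continuous (fun x : EuclideanSpace ℝ (Fin n) => f ‖x‖)) (B : ℝ)
    (hB : ∀ x : EuclideanSpace ℝ (Fin n), |f ‖x‖| ≤ B)
    (hp : ∀ ε, 0 < ε → ∀ y : EuclideanSpace ℝ (Fin n), 0 ≤ specDens f ε y)
    (s : Finset ℕ) (X : ℕ → EuclideanSpace ℝ (Fin n)) (i0 l : Fin n) (hil : i0 ≠ l) (hX : ∀ k, X k i0 = 0)
    (a c : ℝ) (ha : 0 < a) (hc : 0 < c)
    (H : ∀ (ξ : ℕ → ℂ), c * ∑ k ∈ s, ‖ξ k‖ ^ 2 ≤ ∫ t in (-a)..a, ‖∑ j ∈ s, ξ j * Complex.exp (((2 * Real.pi * X j l * t : ℝ) : ℂ) * Complex.I)‖ ^ 2)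
    (s0 κ : ℝ) (hs0 : 0 ≤ s0) (hκ : 0 ≤ κ) (hs : (2 * Real.pi * s0 * a) ^ 2 / 2 ≤ κ) (ξ : ℕ → ℂ) :
    (c / (4 * a) * ∑ k ∈ s, ‖ξ k‖ ^ 2) * ((1 - κ) * f 0 - f s0) ≤
      2 * Real.pi * (∑ j ∈ s, ∑ k ∈ s, ξ k * (starRingEnd ℂ) (ξ j) * ((f ‖X k - X j‖ : ℝ) : ℂ)).re := by
  have h1 : Tendsto (fun ε : ℝ => (c / (4 * a) * ∑ k ∈ s, ‖ξ k‖ ^ 2) * ((1 - κ) * f 0 - f s0 * Real.exp (-ε * s0 ^ 2))) (𝓝[>] 0)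
     (𝓝 ((c / (4 * a) * ∑ k ∈ s, ‖ξ k‖ ^ 2) * ((1 - κ) * f 0 - f s0))) := by
    have : Continuous (fun ε : ℝ => (c / (4 * a) * ∑ k ∈ s, ‖ξ k‖ ^ 2) * ((1 - κ) * f 0 - f s0 * Real.exp (-ε * s0 ^ 2))) := by fun_prop
    have h := this.tendsto 0
    simp only [neg_zero, zero_mul, Real.exp_zero, mul_one] at h
    exact h.mono_left nhdsWithin_le_nhds
  have h2 : Tendsto (fun ε : ℝ => 2 * Real.pi * (∑ j ∈ s, ∑ k ∈ s, ξ k * (starRingEnd ℂ) (ξ j) *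
        ((f ‖X k - X j‖ * Real.exp (-ε * ‖X k - X j‖ ^ 2) : ℝ) : ℂ)).re) (𝓝[>] 0)
     (𝓝 (2 * Real.pi * (∑ j ∈ s, ∑ k ∈ s, ξ k * (starRingEnd ℂ) (ξ j) * ((f ‖X k - X j‖ : ℝ) : ℂ)).re)) := by
    have : Continuous (fun ε : ℝ => 2 * Real.pi * (∑ j ∈ s, ∑ k ∈ s, ξ k * (starRingEnd ℂ) (ξ j) *
        ((f ‖X k - X j‖ * Real.exp (-ε * ‖X k - X j‖ ^ 2) : ℝ) : ℂ)).re) := by fun_prop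
    have h := this.tendsto 0
    simp only [neg_zero, zero_mul, Real.exp_zero, mul_one] at h
    exact h.mono_left nhdsWithin_le_nhds
  refine le_of_tendsto_of_tendsto h1 h2 ?_
  filter_upwards [self_mem_nhdsWithin] with ε (hε : 0 < ε)
  exact main_eps f hfc B hB ε hε (hp ε hε) s X i0 l hil hX a c ha hc H s0 κ hs0 hκ hs ξ

end final

lemma posdef_bound {n : ℕ} (f : ℝ → ℝ)
    (hpd : IsPosDefFn (fun x : EuclideanSpace ℝ (Fin n) => (f ‖x‖ : ℂ))) (x : EuclideanSpace ℝ (Fin n)) :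
    |f ‖x‖| ≤ f 0 := by
  have h1 := hpd.2 2 ![x, 0] ![1, 1]
  have h2 := hpd.2 2 ![x, 0] ![1, -1]
  simp [Fin.sum_univ_two] at h1 h2
  have e1 := (Complex.le_def.mp h1).1
  have e2 := (Complex.le_def.mp h2).1
  simp at e1 e2
  rw [abs_le]
  constructor <;> linarith

lemma posdef_specDens {n : ℕ} (f : ℝ → ℝ)
    (hpd : IsPosDefFn (fun x : EuclideanSpace ℝ (Fin n) => (f ‖x‖ : ℂ)))
    (hfc : Continuous (fun x : EuclideanSpace ℝ (Fin n) => f ‖x‖)) (ε : ℝ) (hε : 0 < ε)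
    (y : EuclideanSpace ℝ (Fin n)) : 0 ≤ specDens f ε y := by
  unfold specDens
  refine pd_gauss (fun u => Real.cos (2 * Real.pi * ⟪u, y⟫) * f ‖u‖)
    (Continuous.mul (by fun_prop) hfc) (f 0) ?_ ?_ ε hε
  · intro x
    rw [abs_mul]
    exact (mul_le_of_le_one_left (abs_nonneg _) (Real.abs_cos_le_one _)).trans (posdef_bound f hpd x)
  · intro m x
    have h1 := (Complex.le_def.mp (hpd.2 m x (fun k => Complex.exp (((2 * Real.pi * ⟪x k, y⟫ : ℝ) : ℂ) * Complex.I)))).1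
    rw [Complex.zero_re, Complex.re_sum] at h1
    refine h1.trans_eq ?_
    apply Finset.sum_congr rfl; intro j _
    rw [Complex.re_sum]
    apply Finset.sum_congr rfl; intro k _
    have e : Complex.exp (((2 * Real.pi * ⟪x k, y⟫ : ℝ) : ℂ) * Complex.I) * (starRingEnd ℂ) (Complex.exp (((2 * Real.pi * ⟪x j, y⟫ : ℝ) : ℂ) * Complex.I))
       = Complex.exp (((2 * Real.pi * ⟪x k - x j, y⟫ : ℝ) : ℂ) * Complex.I) := by
      rw [← Complex.exp_conj, ← Complex.exp_add, map_mul, Complex.conj_ofReal, Complex.conj_I, inner_sub_left]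
      congr 1
      push_cast; ring
    rw [e, Complex.re_mul_ofReal, Complex.exp_ofReal_mul_I_re]

/-- Let `n ≥ 2` and let `f ∈ Φₙ` be nonconstant (continuous on `[0,∞)`
with `x ↦ f(|x|)` positive definite on `ℝⁿ`). Let `X = {x_k}` be points of `ℝⁿ` of the
form `x_k = (0, x_{k2}, …, x_{kn})` and let `Xₙ` be the sequence of `n`-th coordinates.
If `d_*(Xₙ) > 0` and `D*(Xₙ) = 0`, then `x ↦ f(|x|)` is strongly `X`-positive definite. -/
theorem statement_8 (n : ℕ) (hn : 2 ≤ n) (f : ℝ → ℝ)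
    (hcont : ContinuousOn f (Set.Ici 0))
    (hnonconst : ∃ s t : ℝ, 0 ≤ s ∧ 0 ≤ t ∧ f s ≠ f t)
    (hpd : IsPosDefFn (fun x : EuclideanSpace ℝ (Fin n) => (f ‖x‖ : ℂ)))
    (X : ℕ → EuclideanSpace ℝ (Fin n))
    (hX1 : ∀ k, X k ⟨0, by omega⟩ = 0)
    (hsep : ∃ d : ℝ, 0 < d ∧ ∀ k j, k ≠ j →
      d ≤ |X k ⟨n - 1, by omega⟩ - X j ⟨n - 1, by omega⟩|)
    (hdens : upperDensity (fun k => X k ⟨n - 1, by omega⟩) = 0) :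
    IsStronglyPosDef X (fun x => (f ‖x‖ : ℂ)) := by
  have hfc : Continuous (fun x : EuclideanSpace ℝ (Fin n) => f ‖x‖) :=
    hcont.comp_continuous continuous_norm (fun x => norm_nonneg x)
  have hB := posdef_bound f hpd
  have hp := posdef_specDens f hpd hfc
  have hi : (⟨0, by omega⟩ : Fin n) ≠ ⟨n - 1, by omega⟩ := by
    intro h
    have := congrArg Fin.val h
    simp at this
    omega
  have hB' : ∀ t, 0 ≤ t → |f t| ≤ f 0 := by
    intro t ht
    have h := hB (t • EuclideanSpace.single (⟨0, by omega⟩ : Fin n) (1 : ℝ))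
    rwa [norm_smul, PiLp.norm_single, norm_one, mul_one, Real.norm_of_nonneg ht] at h
  obtain ⟨s0, hs0, hlt⟩ : ∃ s0, 0 ≤ s0 ∧ f s0 < f 0 := by
    obtain ⟨s, t, hs, ht, hne⟩ := hnonconst
    by_contra hcon
    push Not at hcon
    have h1 := hcon s hs
    have h2 := hcon t ht
    have h3 := (abs_le.mp (hB' s hs)).2
    have h4 := (abs_le.mp (hB' t ht)).2
    exact hne (by linarith)
  have hf0 : 0 < f 0 := by
    have := (abs_le.mp (hB' s0 hs0)).1
    linarith
  set κ : ℝ := (f 0 - f s0) / (2 * f 0) with hκ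
  have hκ0 : 0 < κ := div_pos (by linarith) (by linarith)
  have hκ1 : (1 - κ) * f 0 - f s0 = (f 0 - f s0) / 2 := by
    rw [hκ]; field_simp; ring
  have hpi := Real.pi_pos
  set a : ℝ := Real.sqrt (2 * κ) / (2 * Real.pi * (s0 + 1)) with ha
  have ha0 : 0 < a := by positivity
  have has : (2 * Real.pi * s0 * a) ^ 2 / 2 ≤ κ := by
    have e : 2 * Real.pi * s0 * a = Real.sqrt (2 * κ) * (s0 / (s0 + 1)) := by
      rw [ha]; field_simp
    rw [e, mul_pow, Real.sq_sqrt (by positivity)]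
    have h1 : s0 / (s0 + 1) ≤ 1 := by rw [div_le_one (by positivity)]; linarith
    have h2 : (s0 / (s0 + 1)) ^ 2 ≤ 1 := pow_le_one₀ (by positivity) h1
    nlinarith
  obtain ⟨d, hd, hsepd⟩ := hsep
  obtain ⟨c, hc, H⟩ := exp_lower_bound _ d hd hsepd hdens a ha0
  refine ⟨c / (4 * a) * ((f 0 - f s0) / 2) / (2 * Real.pi), ?_, ?_⟩
  · have : 0 < f 0 - f s0 := by linarith
    positivity
  intro m y hy hyinj ξ
  choose k hk using hy
  have hkinj : Function.Injective k := by
    intro i j hij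
    apply hyinj
    rw [← hk i, ← hk j, hij]
  classical
  set ξ' : ℕ → ℂ := fun q => if h : ∃ i, k i = q then ξ h.choose else 0 with hξ'
  have hξk : ∀ i, ξ' (k i) = ξ i := by
    intro i
    have h : ∃ j, k j = k i := ⟨i, rfl⟩
    simp only [hξ', dif_pos h]
    rw [hkinj h.choose_spec]
  set s : Finset ℕ := Finset.univ.map ⟨k, hkinj⟩ with hs
  have key := main_zero f hfc (f 0) hB hp s X ⟨0, by omega⟩ ⟨n - 1, by omega⟩ hi hX1 a c ha0 hc
    (fun ξ => H s ξ) s0 κ hs0 hκ0.le has ξ'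
  simp only [hs, Finset.sum_map, Function.Embedding.coeFn_mk, hξk, hk, hκ1] at key
  have him := (Complex.le_def.mp (hpd.2 m y ξ)).2
  refine Complex.le_def.mpr ⟨?_, ?_⟩
  · rw [Complex.ofReal_re]
    have h2 : 0 < 2 * Real.pi := by positivity
    rw [div_mul_eq_mul_div, div_le_iff₀ h2]
    calc _ = (c / (4 * a) * ∑ i, ‖ξ i‖ ^ 2) * ((f 0 - f s0) / 2) := by ring
      _ ≤ _ := key
      _ = _ := by ring
  · rw [Complex.ofReal_im]
    simpa using him
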